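/- arXiv:2104.11974 — 2 statements merged into one kernel-verified Lean document; each statement's English description precedes it below -/
import Mathlib

section
/- There exists a universal constant C > 0 such that for every integer n ≥ 3 and t ≥ 0, if X and Y are independent random vectors in ℝ^n, each with the standard normal distribution N(0, I_n), and T : ℝ^n → ℝ^n is the map that arranges the coordinates of a vector in non-decreasing order, then with probability at least 1 − C·exp(−t²): ‖TX − TY‖_∞ ≤ C·min{t²/√(ln n), t}. -/
open MeasureTheory ProbabilityTheory

/-- The standard Gaussian measure `N(0, I_n)` on `ℝ^n`. -/
noncomputable def stdGaussian (n : ℕ) : Measure (Fin n → ℝ) :=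
  Measure.pi fun _ => gaussianReal 0 1

/-- `sortVec x` arranges the coordinates of `x` in non-decreasing order. -/
noncomputable def sortVec {n : ℕ} (x : Fin n → ℝ) : Fin n → ℝ :=
  fun i => x (Tuple.sort x i)

open Set

/-- The number of coordinates of `x` that lie in `A`. -/
noncomputable def coordCount {ι Ω : Type*} [Fintype ι] (A : Set Ω) (x : ι → Ω) : ℕ :=
  open Classical in (Finset.univ.filter fun i => x i ∈ A).card

section Counting

variable {ι Ω : Type*} [Fintype ι]

lemma coordCount_mono {A B : Set Ω} (h : A ⊆ B) (x : ι → Ω) :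
    coordCount A x ≤ coordCount B x := by
  classical
  unfold coordCount
  exact Finset.card_le_card fun i hi => by
    simp only [Finset.mem_filter, Finset.mem_univ, true_and] at hi ⊢
    exact h hi

lemma coordCount_compl (A : Set Ω) (x : ι → Ω) :
    coordCount Aᶜ x + coordCount A x = Fintype.card ι := by
  classical
  unfold coordCount
  simp only [mem_compl_iff]
  rw [add_comm, Finset.card_filter_add_card_filter_not, Finset.card_univ]

lemma exists_mem_of_coordCount_pos {A : Set Ω} {x : ι → Ω} (h : 0 < coordCount A x) :
    ∃ i, x i ∈ A := by
  classical
  obtain ⟨i, hi⟩ := Finset.card_pos.mp h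
  exact ⟨i, by simpa using hi⟩

lemma prod_indicator_eq_pow_coordCount (A : Set Ω) (x : ι → Ω) (u : ℝ) :
    ∏ i, (1 + A.indicator (fun _ => u - 1) (x i)) = u ^ coordCount A x := by
  classical
  have : ∀ i, 1 + A.indicator (fun _ => u - 1) (x i) = if x i ∈ A then u else 1 := by
    intro i
    by_cases hi : x i ∈ A <;> simp [hi]
  simp only [this, Finset.prod_ite, Finset.prod_const, one_pow, mul_one]
  rfl

lemma lt_coordCount_Iic_iff {n : ℕ} (x : Fin n → ℝ) (i : Fin n) (a : ℝ) :
    (i : ℕ) < coordCount (Iic a) x ↔ sortVec x i ≤ a := by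
  classical
  have h := Tuple.lt_card_le_iff_apply_le_of_monotone (f := sortVec x) (j := i) (a := a)
    (Tuple.monotone_sort x)
  rw [← h]
  have : coordCount (Iic a) x = (Finset.univ.filter fun k => sortVec x k ≤ a).card := by
    unfold coordCount sortVec
    refine Finset.card_equiv (Tuple.sort x).symm fun k => ?_
    simp
  rw [this]

/-- If the empirical distribution functions of `x` and `y` interlace along the grid `δ ℤ`, then the
order statistics of `y` exceed those of `x` by at most `2 δ`. -/
lemma sortVec_le_sortVec_add {n : ℕ} {x y : Fin n → ℝ} {δ : ℝ} (hδ : 0 < δ)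
    (h : ∀ j : ℤ, coordCount (Iic (j * δ)) x ≤ coordCount (Iic ((j + 1) * δ)) y) (i : Fin n) :
    sortVec y i ≤ sortVec x i + 2 * δ := by
  set j := ⌈sortVec x i / δ⌉ with hj
  have h1 : sortVec x i ≤ j * δ := by
    rw [← div_le_iff₀ hδ]; exact Int.le_ceil _
  have h2 : (j : ℝ) * δ ≤ sortVec x i + δ := by
    have := (Int.ceil_lt_add_one (sortVec x i / δ)).le
    calc (j : ℝ) * δ ≤ (sortVec x i / δ + 1) * δ := by gcongr
      _ = _ := by field_simp
  have h3 := (lt_coordCount_Iic_iff x i _).mpr h1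
  have h4 := (lt_coordCount_Iic_iff y i _).mp (h3.trans_le (h j))
  linarith

/-- Failure of the conclusion of `sortVec_le_sortVec_add` is witnessed in one of the two tails. -/
lemma exists_coordCount_lt_of_sortVec {n : ℕ} {x y : Fin n → ℝ} {δ : ℝ} (hδ : 0 < δ)
    (h : ∃ i, sortVec x i + 2 * δ < sortVec y i) :
    ∃ j : ℕ, coordCount (Ioi (j * δ)) x < coordCount (Ioi ((j + 1) * δ)) y ∨
      coordCount (Iic (-(j * δ))) y < coordCount (Iic (-((j + 1) * δ))) x := by
  by_contra! hc
  obtain ⟨i, hi⟩ := h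
  refine hi.not_ge (sortVec_le_sortVec_add hδ (fun j => ?_) i)
  rcases le_or_gt 0 j with hj | hj
  · lift j to ℕ using hj
    have h1 := (hc j).1
    have hx := coordCount_compl (Iic ((j : ℝ) * δ)) x
    have hy := coordCount_compl (Iic (((j : ℝ) + 1) * δ)) y
    rw [compl_Iic] at hx hy
    push_cast
    omega
  · obtain ⟨k, rfl⟩ : ∃ k : ℕ, j = -((k : ℤ) + 1) := ⟨(-j - 1).toNat, by omega⟩
    have h2 := (hc k).2
    push_cast
    convert h2 using 2 <;> congr 1 <;> ring

end Counting

section Chernoff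

variable {ι Ω : Type*} [Fintype ι] [MeasurableSpace Ω] (γ : Measure Ω) [IsProbabilityMeasure γ]

lemma integral_pow_coordCount {A : Set Ω} (hA : MeasurableSet A) (u : ℝ) :
    Integrable (fun x : ι → Ω => u ^ coordCount A x) (Measure.pi fun _ => γ) ∧
    ∫ x : ι → Ω, u ^ coordCount A x ∂(Measure.pi fun _ => γ) =
      (1 + (u - 1) * γ.real A) ^ Fintype.card ι := by
  have hint : Integrable (fun x => 1 + A.indicator (fun _ => u - 1) x) γ :=
    (integrable_const _).add ((integrable_const _).indicator hA)
  simp only [← prod_indicator_eq_pow_coordCount]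
  refine ⟨Integrable.fintype_prod fun _ => hint, ?_⟩
  rw [integral_fintype_prod_eq_pow (fun x => 1 + A.indicator (fun _ => u - 1) x),
    integral_add (integrable_const _) ((integrable_const _).indicator hA),
    integral_indicator_const _ hA]
  simp [mul_comm]

/-- Two-sample Chernoff bound: if `B` has much smaller probability than `A`, then an independent
sample is unlikely to hit `B` more often than the other sample hits `A`. -/
lemma measureReal_coordCount_lt_le {A B : Set Ω} (hA : MeasurableSet A) (hB : MeasurableSet B)
    {u : ℝ} (hu0 : 0 < u) (hu1 : u ≤ 1) (h : γ.real B ≤ u ^ 2 * γ.real A) :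
    ((Measure.pi fun _ : ι => γ).prod (Measure.pi fun _ : ι => γ)).real
        {xy | coordCount A xy.1 < coordCount B xy.2} ≤
      u * Real.exp (-(Fintype.card ι * γ.real A * (1 - u) ^ 2)) := by
  obtain ⟨iA, eA⟩ := integral_pow_coordCount (ι := ι) γ hA u
  obtain ⟨iB, eB⟩ := integral_pow_coordCount (ι := ι) γ hB u⁻¹
  have hu1' : 1 ≤ u⁻¹ := (one_le_inv₀ hu0).mpr hu1
  have key := mul_meas_ge_le_integral_of_nonneg
    (μ := (Measure.pi fun _ : ι => γ).prod (Measure.pi fun _ : ι => γ))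
    (f := fun xy : (ι → Ω) × (ι → Ω) => u ^ coordCount A xy.1 * u⁻¹ ^ coordCount B xy.2)
    (Filter.Eventually.of_forall fun _ => by positivity) (iA.mul_prod iB) u⁻¹
  rw [integral_prod_mul (fun x : ι → Ω => u ^ coordCount A x)
    (fun x : ι → Ω => u⁻¹ ^ coordCount B x), eA, eB, ← mul_pow] at key
  have hsub : {xy : (ι → Ω) × (ι → Ω) | coordCount A xy.1 < coordCount B xy.2} ⊆
      {xy | u⁻¹ ≤ u ^ coordCount A xy.1 * u⁻¹ ^ coordCount B xy.2} := by
    intro xy hxy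
    simp only [mem_ofPred_eq] at hxy ⊢
    obtain ⟨k, hk⟩ := Nat.exists_eq_add_of_lt hxy
    rw [hk, add_assoc, pow_add, ← mul_assoc, ← mul_pow, mul_inv_cancel₀ hu0.ne', one_pow, one_mul,
      pow_succ]
    exact le_mul_of_one_le_left (by positivity) (one_le_pow₀ hu1')
  have hp0 : 0 ≤ γ.real A := measureReal_nonneg
  have hp1 : γ.real A ≤ 1 := measureReal_le_one
  have hq0 : 0 ≤ γ.real B := measureReal_nonneg
  have hbase : (1 + (u - 1) * γ.real A) * (1 + (u⁻¹ - 1) * γ.real B) ≤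
      Real.exp (-(γ.real A * (1 - u) ^ 2)) := by
    have h1 : 1 + (u - 1) * γ.real A ≤ Real.exp ((u - 1) * γ.real A) := by
      linarith [Real.add_one_le_exp ((u - 1) * γ.real A)]
    have h2 : 1 + (u⁻¹ - 1) * γ.real B ≤ Real.exp ((u⁻¹ - 1) * γ.real B) := by
      linarith [Real.add_one_le_exp ((u⁻¹ - 1) * γ.real B)]
    have h3 : 0 ≤ 1 + (u⁻¹ - 1) * γ.real B := by
      have := mul_nonneg (sub_nonneg.mpr hu1') hq0
      linarith
    refine (mul_le_mul h1 h2 h3 (by positivity)).trans ?_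
    rw [← Real.exp_add, Real.exp_le_exp]
    have h4 : (u⁻¹ - 1) * γ.real B ≤ (u⁻¹ - 1) * (u ^ 2 * γ.real A) :=
      mul_le_mul_of_nonneg_left h (sub_nonneg.mpr hu1')
    have h5 : (u⁻¹ - 1) * (u ^ 2 * γ.real A) = (u - u ^ 2) * γ.real A := by
      field_simp
    nlinarith
  have hbase0 : 0 ≤ (1 + (u - 1) * γ.real A) * (1 + (u⁻¹ - 1) * γ.real B) := by
    apply mul_nonneg
    · nlinarith
    · have := mul_nonneg (sub_nonneg.mpr hu1') hq0
      linarith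
  have hpow := pow_le_pow_left₀ hbase0 hbase (Fintype.card ι)
  rw [← Real.exp_nat_mul] at hpow
  have hmono := measureReal_mono hsub
    (measure_ne_top ((Measure.pi fun _ : ι => γ).prod (Measure.pi fun _ : ι => γ)) _)
  have hfin := (mul_le_mul_of_nonneg_left hmono (inv_nonneg.mpr hu0.le)).trans (key.trans hpow)
  rw [inv_mul_le_iff₀ hu0] at hfin
  refine hfin.trans_eq ?_
  congr 2
  ring

/-- First-moment bound for the event that some coordinate lands in `B`. -/
lemma measureReal_exists_mem_le {B : Set Ω} (hB : MeasurableSet B) :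
    (Measure.pi fun _ : ι => γ).real {x | ∃ i, x i ∈ B} ≤ Fintype.card ι * γ.real B := by
  have : {x : ι → Ω | ∃ i, x i ∈ B} = ⋃ i, (fun x : ι → Ω => x i) ⁻¹' B := by ext; simp
  rw [this]
  refine (measureReal_iUnion_fintype_le _).trans ?_
  have h : ∀ i : ι, (Measure.pi fun _ : ι => γ).real ((fun x : ι → Ω => x i) ⁻¹' B) = γ.real B :=
    fun i => (measurePreserving_eval (fun _ : ι => γ) i).measureReal_preimage hB.nullMeasurableSet
  simp [h]

end Chernoff

section Gaussian

/-- The upper tail of the standard Gaussian. -/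
noncomputable def gaussianTail (x : ℝ) : ℝ := (gaussianReal 0 1).real (Set.Ioi x)

lemma gaussianReal_real_eq_integral (μ : ℝ) (s : Set ℝ) :
    (gaussianReal μ 1).real s = ∫ x in s, gaussianPDFReal μ 1 x := by
  rw [measureReal_def, gaussianReal_apply_eq_integral μ one_ne_zero, ENNReal.toReal_ofReal]
  exact integral_nonneg fun x => gaussianPDFReal_nonneg _ _ _

lemma gaussianReal_real_Iic_neg (x : ℝ) :
    (gaussianReal 0 1).real (Set.Iic (-x)) = gaussianTail x := by
  have h : (gaussianReal 0 1).map (fun x : ℝ => -x) = gaussianReal 0 1 := by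
    rw [gaussianReal_map_neg, neg_zero]
  have := nullSingletonClass_gaussianReal (μ := 0) (v := 1) one_ne_zero
  rw [gaussianTail, ← measureReal_congr (Ioi_ae_eq_Ici' (measure_singleton x)).symm,
    ← h, map_measureReal_apply (by fun_prop) measurableSet_Iic, h]
  congr 1
  ext y
  simp

lemma gaussianTail_nonneg (x : ℝ) : 0 ≤ gaussianTail x := measureReal_nonneg

lemma gaussianTail_le_one (x : ℝ) : gaussianTail x ≤ 1 := measureReal_le_one

lemma gaussianTail_add_le (x : ℝ) {δ : ℝ} (hδ : 0 ≤ δ) :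
    gaussianTail (x + δ) ≤ Real.exp (-(x * δ + δ ^ 2 / 2)) * gaussianTail x := by
  have h : (gaussianReal 0 1).map (fun y => y + (-δ)) = gaussianReal (-δ) 1 := by
    rw [gaussianReal_map_add_const, zero_add]
  have h1 : gaussianTail (x + δ) = (gaussianReal (-δ) 1).real (Set.Ioi x) := by
    rw [← h, map_measureReal_apply (by fun_prop) measurableSet_Ioi, gaussianTail]
    congr 1
    ext y
    simp only [Set.mem_Ioi, Set.mem_preimage]
    constructor <;> intro h <;> linarith
  rw [h1, gaussianTail, gaussianReal_real_eq_integral, gaussianReal_real_eq_integral,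
    ← integral_const_mul]
  refine setIntegral_mono_on (integrable_gaussianPDFReal _ _).integrableOn
    ((integrable_gaussianPDFReal _ _).integrableOn.const_mul _) measurableSet_Ioi ?_
  intro y hy
  simp only [gaussianPDFReal_def]
  rw [mul_left_comm, ← Real.exp_add]
  gcongr
  have : x * δ ≤ y * δ := mul_le_mul_of_nonneg_right (le_of_lt hy) hδ
  simp only [NNReal.coe_one]
  nlinarith

lemma gaussianTail_le {x : ℝ} (hx : 0 ≤ x) : gaussianTail x ≤ Real.exp (-(x ^ 2 / 2)) := by
  have h := gaussianTail_add_le 0 hx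
  rw [zero_add, zero_mul, zero_add] at h
  exact h.trans (mul_le_of_le_one_right (Real.exp_nonneg _) (gaussianTail_le_one _))

lemma exp_neg_sq_le_gaussianTail {x : ℝ} (hx : 0 ≤ x) :
    Real.exp (-x ^ 2) / 8 ≤ gaussianTail x := by
  have h1 : (gaussianReal 0 1).real (Set.Ioc x (x + 1)) ≤ gaussianTail x :=
    measureReal_mono Set.Ioc_subset_Ioi_self
  refine le_trans ?_ h1
  rw [gaussianReal_real_eq_integral]
  have h2 : ∫ _ in Set.Ioc x (x + 1), gaussianPDFReal 0 1 (x + 1) ≤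
      ∫ y in Set.Ioc x (x + 1), gaussianPDFReal 0 1 y := by
    refine setIntegral_mono_on (by simp) (integrable_gaussianPDFReal _ _).integrableOn
      measurableSet_Ioc ?_
    intro y hy
    simp only [gaussianPDFReal_def]
    have h0 : 0 ≤ y := hx.trans hy.1.le
    have h3 : y ≤ x + 1 := hy.2
    gcongr
  refine le_trans ?_ h2
  simp only [integral_const, measureReal_restrict_apply_univ, Real.volume_real_Ioc, smul_eq_mul]
  rw [gaussianPDFReal_def]
  simp only [NNReal.coe_one, mul_one, sub_zero, add_sub_cancel_left]
  rw [max_eq_left zero_le_one, one_mul]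
  have h4 : Real.exp (-x ^ 2) * Real.exp (-1) ≤ Real.exp (-(x + 1) ^ 2 / 2) := by
    rw [← Real.exp_add, Real.exp_le_exp]
    nlinarith [sq_nonneg (x - 1)]
  have h5 : (1 : ℝ) / 8 ≤ (√(2 * Real.pi))⁻¹ * Real.exp (-1) := by
    have hs : √(2 * Real.pi) ≤ 2.6 := by
      rw [Real.sqrt_le_left (by norm_num)]
      nlinarith [Real.pi_lt_d2]
    have hs0 : 0 < √(2 * Real.pi) := by positivity
    rw [Real.exp_neg, ← mul_inv, div_eq_mul_inv, one_mul]
    apply inv_anti₀ (by positivity)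
    have := Real.exp_one_lt_d9
    nlinarith [Real.exp_pos 1]
  calc Real.exp (-x ^ 2) / 8 = Real.exp (-x ^ 2) * (1 / 8) := by ring
    _ ≤ Real.exp (-x ^ 2) * ((√(2 * Real.pi))⁻¹ * Real.exp (-1)) := by gcongr
    _ = (√(2 * Real.pi))⁻¹ * (Real.exp (-x ^ 2) * Real.exp (-1)) := by ring
    _ ≤ _ := by gcongr

end Gaussian

section Series

/-- Both `a` and `1 / a` are controlled by an increment of the bounded function `a / (1 + a)`, so
that their minimum is summable along geometrically decaying sequences. -/
lemma le_telescope_of_le_half {a b m : ℝ} (ha : 0 < a) (hb : 0 ≤ b) (hab : b ≤ a / 2)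
    (h1 : m ≤ a) (h2 : m ≤ 1 / a) : m ≤ 6 * (a / (1 + a) - b / (1 + b)) := by
  have h3 : b / (1 + b) ≤ (a / 2) / (1 + a / 2) := by
    rw [div_le_div_iff₀ (by positivity) (by positivity)]
    nlinarith
  have h4 : a / (1 + a) - (a / 2) / (1 + a / 2) = a / ((1 + a) * (2 + a)) := by
    field_simp
    ring
  suffices h5 : m ≤ 6 * (a / ((1 + a) * (2 + a))) by linarith
  rw [← mul_div_assoc, le_div_iff₀ (by positivity)]
  rw [le_div_iff₀ ha] at h2
  rcases le_total a 1 with h | h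
  · have h6 : (1 + a) * (2 + a) ≤ 6 := by nlinarith
    nlinarith [mul_le_mul_of_nonneg_right h1 (show 0 ≤ (1 + a) * (2 + a) by positivity),
      mul_le_mul_of_nonneg_left h6 ha.le]
  · have h6 : (1 + a) * (2 + a) ≤ 6 * a ^ 2 := by nlinarith
    rcases le_total m 0 with hm | hm
    · have := mul_nonneg (neg_nonneg.mpr hm) (show 0 ≤ (1 + a) * (2 + a) by positivity)
      nlinarith
    · nlinarith [mul_le_mul_of_nonneg_left h6 hm, mul_le_mul_of_nonneg_right h2 ha.le]

/-- The constant in the tail estimate `sum_range_le_tailConst`. -/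
noncomputable def tailConst : ℝ := 24 + 2 * Real.exp 12288

lemma two_mul_exp_mul_exp_le {L : ℝ} (hL : 1 ≤ L) :
    2 * L * Real.exp (-(Real.exp (L / 2) / (32 * L ^ 2))) ≤
      2 * Real.exp 12288 * Real.exp (-L) := by
  have h1 : L ≤ Real.exp L := by linarith [Real.add_one_le_exp L]
  have h2 : L ^ 4 / 384 ≤ Real.exp (L / 2) := by
    have h := Real.pow_div_factorial_le_exp (L / 2) (by linarith) 4
    norm_num [Nat.factorial] at h
    linarith [h, show (L / 2) ^ 4 / 24 = L ^ 4 / 384 by ring]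
  have h3 : L ^ 2 / 12288 ≤ Real.exp (L / 2) / (32 * L ^ 2) := by
    rw [le_div_iff₀ (by positivity)]
    refine le_trans (le_of_eq ?_) h2
    ring
  have h4 : L + -(Real.exp (L / 2) / (32 * L ^ 2)) ≤ 12288 + -L := by
    nlinarith [sq_nonneg (L - 12288)]
  calc 2 * L * Real.exp (-(Real.exp (L / 2) / (32 * L ^ 2)))
      ≤ 2 * Real.exp L * Real.exp (-(Real.exp (L / 2) / (32 * L ^ 2))) := by gcongr
    _ = 2 * Real.exp (L + -(Real.exp (L / 2) / (32 * L ^ 2))) := by rw [Real.exp_add]; ring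
    _ ≤ 2 * Real.exp (12288 + -L) := by gcongr
    _ = _ := by rw [Real.exp_add]; ring

lemma gaussianTail_pos {x : ℝ} (hx : 0 ≤ x) : 0 < gaussianTail x :=
  lt_of_lt_of_le (by positivity) (exp_neg_sq_le_gaussianTail hx)

/-- In the bulk, where the grid point `x` satisfies `x ≤ √L / 2`, the Chernoff bound is
super-polynomially small. -/
lemma chernoff_bulk_le {L t δ x c u : ℝ} (hL : 1 ≤ L) (ht : 1 ≤ t) (hδ : δ = 4 * t ^ 2 / √L)
    (hx : 0 ≤ x) (hu : u = Real.exp (-(x * δ + δ ^ 2 / 2) / 2))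
    (hc : c ≤ u * Real.exp (-(Real.exp L * gaussianTail x * (1 - u) ^ 2))) (hxL : x ≤ √L / 2) :
    c ≤ Real.exp (-(Real.exp (L / 2) / (32 * L ^ 2))) := by
  have hδ0 : 0 ≤ δ := by rw [hδ]; positivity
  have hδ2 : 16 / L ≤ δ ^ 2 := by
    rw [hδ, div_pow, Real.sq_sqrt (by linarith)]
    have : 1 ≤ t ^ 4 := one_le_pow₀ ht
    gcongr
    nlinarith
  have hx2 : x ^ 2 ≤ L / 4 := by
    have := pow_le_pow_left₀ hx hxL 2
    rwa [div_pow, Real.sq_sqrt (by linarith), show (2 : ℝ) ^ 2 = 4 by norm_num] at this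
  have hp : Real.exp (L / 2) / 8 ≤ Real.exp L * gaussianTail x := by
    refine le_trans ?_ (mul_le_mul_of_nonneg_left (exp_neg_sq_le_gaussianTail hx)
      (Real.exp_nonneg L))
    rw [← mul_div_assoc, ← Real.exp_add]
    gcongr
    linarith
  have hu1 : u ≤ 1 - 1 / (2 * L) := by
    have h1 : u ≤ Real.exp (-(4 / L)) := by
      rw [hu, Real.exp_le_exp]
      have := mul_nonneg hx hδ0
      have h16 : 16 / L = 4 * (4 / L) := by ring
      linarith
    have h2 : Real.exp (-(4 / L)) ≤ (1 + 4 / L)⁻¹ := by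
      rw [Real.exp_neg]
      apply inv_anti₀ (by positivity)
      linarith [Real.add_one_le_exp (4 / L)]
    have h3 : (1 + 4 / L)⁻¹ ≤ 1 - 1 / (2 * L) := by
      rw [inv_le_iff_one_le_mul₀ (by positivity)]
      have : (1 - 1 / (2 * L)) * (1 + 4 / L) = 1 + (7 * L - 4) / (2 * L ^ 2) := by
        field_simp
        ring
      rw [this]
      have : 0 ≤ (7 * L - 4) / (2 * L ^ 2) := div_nonneg (by linarith) (by positivity)
      linarith
    exact h1.trans (h2.trans h3)
  have hu0 : 0 < u := by rw [hu]; positivity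
  have hL0 : 0 < 1 / (2 * L) := by positivity
  have h4 : (1 / (2 * L)) ^ 2 ≤ (1 - u) ^ 2 := pow_le_pow_left₀ hL0.le (by linarith) 2
  calc c ≤ u * Real.exp (-(Real.exp L * gaussianTail x * (1 - u) ^ 2)) := hc
    _ ≤ 1 * Real.exp (-(Real.exp (L / 2) / 8 * (1 / (2 * L)) ^ 2)) := by
      have : Real.exp (L / 2) / 8 * (1 / (2 * L)) ^ 2 ≤
          Real.exp L * gaussianTail x * (1 - u) ^ 2 :=
        mul_le_mul hp h4 (by positivity) (le_trans (by positivity) hp)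
      gcongr
      linarith
    _ = _ := by
      rw [one_mul]
      congr 2
      field_simp
      norm_num

/-- In the tail, where the grid point `x` satisfies `√L / 2 ≤ x`, the expected number of points
beyond `x` decays geometrically along the grid, and the error terms telescope. -/
lemma chernoff_tail_le {L t δ x c u : ℝ} (hL : 1 ≤ L) (ht : 1 ≤ t) (hδ : δ = 4 * t ^ 2 / √L)
    (hx : 0 ≤ x) (hu : u = Real.exp (-(x * δ + δ ^ 2 / 2) / 2))
    (hc : c ≤ u * Real.exp (-(Real.exp L * gaussianTail x * (1 - u) ^ 2)))
    (hc' : c ≤ Real.exp L * gaussianTail (x + δ)) (hxL : √L / 2 ≤ x) :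
    c ≤ 24 * Real.exp (-t ^ 2) *
      (Real.exp L * gaussianTail x / (1 + Real.exp L * gaussianTail x) -
        Real.exp L * gaussianTail (x + δ) / (1 + Real.exp L * gaussianTail (x + δ))) := by
  have hs : 0 < √L := Real.sqrt_pos.mpr (by linarith)
  have hδ0 : 0 ≤ δ := by rw [hδ]; positivity
  have ht2 : 1 ≤ t ^ 2 := one_le_pow₀ ht
  have hxδ : 2 * t ^ 2 ≤ x * δ := by
    calc 2 * t ^ 2 = √L / 2 * δ := by rw [hδ]; field_simp; norm_num
      _ ≤ x * δ := by gcongr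
  set a := Real.exp L * gaussianTail x with ha
  set b := Real.exp L * gaussianTail (x + δ) with hb
  have ha0 : 0 < a := mul_pos (Real.exp_pos _) (gaussianTail_pos hx)
  have hb0 : 0 ≤ b := mul_nonneg (Real.exp_nonneg _) (gaussianTail_nonneg _)
  have hdec : b ≤ Real.exp (-(2 * t ^ 2)) * a := by
    calc b ≤ Real.exp L * (Real.exp (-(x * δ + δ ^ 2 / 2)) * gaussianTail x) :=
          mul_le_mul_of_nonneg_left (gaussianTail_add_le x hδ0) (Real.exp_nonneg _)
      _ = Real.exp (-(x * δ + δ ^ 2 / 2)) * a := by rw [ha]; ring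
      _ ≤ Real.exp (-(2 * t ^ 2)) * a := by
        gcongr
        linarith [sq_nonneg δ]
  have hexp1 : Real.exp (-t ^ 2) ≤ 1 / 2 := by
    calc Real.exp (-t ^ 2) ≤ Real.exp (-1) := by gcongr
      _ ≤ 1 / 2 := by
        rw [Real.exp_neg, one_div]
        apply inv_anti₀ two_pos
        linarith [Real.add_one_le_exp 1]
  have hexp2 : Real.exp (-(2 * t ^ 2)) ≤ Real.exp (-t ^ 2) := by
    gcongr
    linarith
  have hu1 : u ≤ Real.exp (-t ^ 2) := by
    rw [hu, Real.exp_le_exp]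
    linarith [sq_nonneg δ]
  have hu0 : 0 < u := by rw [hu]; positivity
  have hE := Real.exp_pos (-t ^ 2)
  have hm1 : c / (4 * Real.exp (-t ^ 2)) ≤ a := by
    rw [div_le_iff₀ (by positivity)]
    nlinarith [mul_le_mul_of_nonneg_right hexp2 ha0.le, mul_pos hE ha0]
  have hm2 : c / (4 * Real.exp (-t ^ 2)) ≤ 1 / a := by
    have h1 : (1 / 2 : ℝ) ^ 2 ≤ (1 - u) ^ 2 := pow_le_pow_left₀ (by norm_num) (by linarith) 2
    have h2 : Real.exp (-(a * (1 - u) ^ 2)) ≤ 4 / a := by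
      rw [Real.exp_neg, show 4 / a = (a / 4)⁻¹ by rw [inv_div]]
      apply inv_anti₀ (by positivity)
      have h3 : a * (1 / 2) ^ 2 ≤ a * (1 - u) ^ 2 := by gcongr
      linarith [Real.add_one_le_exp (a * (1 - u) ^ 2)]
    rw [div_le_iff₀ (by positivity)]
    calc c ≤ Real.exp (-t ^ 2) * (4 / a) := hc.trans (by gcongr)
      _ = _ := by ring
  have hmain := le_telescope_of_le_half ha0 hb0 (by nlinarith) hm1 hm2
  rw [div_le_iff₀ (by positivity)] at hmain
  linarith

/-- Summation of the Chernoff bounds over the whole grid `δ ℕ`. -/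
lemma sum_range_le_tailConst {L t δ : ℝ} (hL : 1 ≤ L) (ht : 1 ≤ t) (htL : t ^ 2 ≤ L)
    (hδ : δ = 4 * t ^ 2 / √L) {c u : ℕ → ℝ}
    (hu : ∀ j : ℕ, u j = Real.exp (-(j * δ * δ + δ ^ 2 / 2) / 2))
    (hc : ∀ j : ℕ, c j ≤ u j * Real.exp (-(Real.exp L * gaussianTail (j * δ) * (1 - u j) ^ 2)))
    (hc' : ∀ j : ℕ, c j ≤ Real.exp L * gaussianTail ((j + 1) * δ)) (N : ℕ) :
    ∑ j ∈ Finset.range N, c j ≤ tailConst * Real.exp (-t ^ 2) := by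
  have hs : 0 < √L := Real.sqrt_pos.mpr (by linarith)
  have hδ0 : 0 < δ := by rw [hδ]; positivity
  have ht2 : 1 ≤ t ^ 2 := one_le_pow₀ ht
  set G : ℕ → ℝ := fun j => Real.exp L * gaussianTail (j * δ) /
    (1 + Real.exp L * gaussianTail (j * δ)) with hG
  set β := Real.exp (-(Real.exp (L / 2) / (32 * L ^ 2))) with hβ
  have hpos : ∀ j : ℕ, 0 < Real.exp L * gaussianTail (j * δ) := fun j =>
    mul_pos (Real.exp_pos _) (gaussianTail_pos (by positivity))
  have hanti : ∀ j, G (j + 1) ≤ G j := by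
    intro j
    have h1 := hpos j
    have h2 := hpos (j + 1)
    have h3 : Real.exp L * gaussianTail ((j + 1 : ℕ) * δ) ≤ Real.exp L * gaussianTail (j * δ) := by
      unfold gaussianTail
      refine mul_le_mul_of_nonneg_left (measureReal_mono (Ioi_subset_Ioi ?_)) (Real.exp_nonneg _)
      gcongr
      simp
    simp only [hG]
    rw [div_le_div_iff₀ (by positivity) (by positivity)]
    linarith
  have hterm : ∀ j, c j ≤ 24 * Real.exp (-t ^ 2) * (G j - G (j + 1)) +
      if (j : ℝ) ≤ L then β else 0 := by
    intro j
    have hsub : 0 ≤ 24 * Real.exp (-t ^ 2) * (G j - G (j + 1)) :=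
      mul_nonneg (by positivity) (sub_nonneg.mpr (hanti j))
    have hx : 0 ≤ (j : ℝ) * δ := by positivity
    rcases le_total ((j : ℝ) * δ) (√L / 2) with h | h
    · have hj : (j : ℝ) ≤ L := by
        rw [hδ, mul_div_assoc', div_le_iff₀ hs] at h
        have : √L / 2 * √L = L / 2 := by
          rw [div_mul_eq_mul_div, Real.mul_self_sqrt (by linarith)]
        nlinarith [(Nat.cast_nonneg j : (0 : ℝ) ≤ j)]
      rw [if_pos hj]
      linarith [chernoff_bulk_le hL ht hδ hx (hu j) (hc j) h]
    · have hadd : (j : ℝ) * δ + δ = (j + 1) * δ := by ring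
      have := chernoff_tail_le hL ht hδ hx (hu j) (hc j) (by rw [hadd]; exact hc' j) h
      rw [hadd] at this
      have hite : 0 ≤ if (j : ℝ) ≤ L then β else 0 := by split_ifs <;> positivity
      refine this.trans ?_
      simp only [hG, Nat.cast_add, Nat.cast_one]
      linarith
  have hcount : ∑ j ∈ Finset.range N, (if (j : ℝ) ≤ L then β else 0) ≤ 2 * L * β := by
    rw [← Finset.sum_filter, Finset.sum_const, nsmul_eq_mul]
    have hsub : (Finset.range N).filter (fun j : ℕ => (j : ℝ) ≤ L) ⊆
        Finset.range (⌊L⌋₊ + 1) := by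
      intro j hj
      rw [Finset.mem_filter] at hj
      rw [Finset.mem_range, Nat.lt_succ_iff]
      exact Nat.le_floor hj.2
    have h1 := Finset.card_le_card hsub
    rw [Finset.card_range] at h1
    have h2 : (((Finset.range N).filter (fun j : ℕ => (j : ℝ) ≤ L)).card : ℝ) ≤ ⌊L⌋₊ + 1 := by
      exact_mod_cast h1
    have h3 := Nat.floor_le (show 0 ≤ L by linarith)
    gcongr
    linarith
  have hGle : G 0 - G N ≤ 1 := by
    have h1 : G 0 ≤ 1 := by
      have := hpos 0
      simp only [hG]
      rw [div_le_one (by positivity)]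
      linarith
    have h2 : 0 ≤ G N := by
      have := hpos N
      positivity
    linarith
  have hexp : Real.exp (-L) ≤ Real.exp (-t ^ 2) := by gcongr
  calc ∑ j ∈ Finset.range N, c j
      ≤ ∑ j ∈ Finset.range N, (24 * Real.exp (-t ^ 2) * (G j - G (j + 1)) +
          if (j : ℝ) ≤ L then β else 0) := Finset.sum_le_sum fun j _ => hterm j
    _ ≤ 24 * Real.exp (-t ^ 2) * (G 0 - G N) + 2 * L * β := by
      rw [Finset.sum_add_distrib, ← Finset.mul_sum, Finset.sum_range_sub']
      linarith
    _ ≤ 24 * Real.exp (-t ^ 2) * 1 + 2 * Real.exp 12288 * Real.exp (-t ^ 2) := by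
      have := two_mul_exp_mul_exp_le hL
      have h2 : 2 * Real.exp 12288 * Real.exp (-L) ≤ 2 * Real.exp 12288 * Real.exp (-t ^ 2) := by
        gcongr
      have h3 := mul_le_mul_of_nonneg_left hGle
        (show 0 ≤ 24 * Real.exp (-t ^ 2) by positivity)
      linarith
    _ = tailConst * Real.exp (-t ^ 2) := by rw [tailConst]; ring

end Series

section Probability

lemma measureReal_iUnion_le_of_sum_range_le {α : Type*} [MeasurableSpace α] {μ : Measure α}
    [IsFiniteMeasure μ] {E : ℕ → Set α} {c : ℝ}
    (h : ∀ N, ∑ j ∈ Finset.range N, μ.real (E j) ≤ c) : μ.real (⋃ j, E j) ≤ c := by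
  have hc : 0 ≤ c := by simpa using h 0
  rw [measureReal_def]
  refine ENNReal.toReal_le_of_le_ofReal hc ((measure_iUnion_le E).trans ?_)
  refine ENNReal.tsum_le_of_sum_range_le fun N => ?_
  rw [ENNReal.le_ofReal_iff_toReal_le (by simp) hc, ENNReal.toReal_sum (by simp)]
  exact h N

lemma measureReal_prod_swap {α : Type*} [MeasurableSpace α] (ν : Measure α) [SFinite ν]
    (P : α → α → Prop) :
    (ν.prod ν).real {xy | P xy.2 xy.1} = (ν.prod ν).real {xy | P xy.1 xy.2} := by
  rw [measureReal_def, measureReal_def]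
  congr 1
  exact (Measure.measurePreserving_swap (μ := ν) (ν := ν)).measure_preimage_equiv
    (f := MeasurableEquiv.prodComm) {xy | P xy.1 xy.2}

instance isProbabilityMeasure_stdGaussian_pi (n : ℕ) :
    IsProbabilityMeasure (stdGaussian n) := by
  unfold _root_.stdGaussian
  infer_instance

/-- Union bound over a sequence of pairs of sets having Gaussian-tail probabilities. -/
lemma measureReal_exists_coordCount_lt_le {n : ℕ} {t δ : ℝ} (hL : 1 ≤ Real.log n) (ht : 1 ≤ t)
    (htL : t ^ 2 ≤ Real.log n) (hδ : δ = 4 * t ^ 2 / √(Real.log n)) {A B : ℕ → Set ℝ}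
    (hA : ∀ j, MeasurableSet (A j)) (hB : ∀ j, MeasurableSet (B j))
    (hpA : ∀ j : ℕ, (gaussianReal 0 1).real (A j) = gaussianTail (j * δ))
    (hpB : ∀ j : ℕ, (gaussianReal 0 1).real (B j) = gaussianTail ((j + 1) * δ)) :
    ((stdGaussian n).prod (stdGaussian n)).real
      {xy | ∃ j, coordCount (A j) xy.1 < coordCount (B j) xy.2} ≤
      tailConst * Real.exp (-t ^ 2) := by
  have hn : Real.exp (Real.log n) = n := by
    refine Real.exp_log (Nat.cast_pos.mpr (Nat.pos_of_ne_zero ?_))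
    rintro rfl
    norm_num at hL
  have hs : 0 < √(Real.log n) := Real.sqrt_pos.mpr (by linarith)
  have hδ0 : 0 ≤ δ := by rw [hδ]; positivity
  rw [show {xy : (Fin n → ℝ) × (Fin n → ℝ) |
      ∃ j, coordCount (A j) xy.1 < coordCount (B j) xy.2} =
      ⋃ j, {xy | coordCount (A j) xy.1 < coordCount (B j) xy.2} by ext; simp]
  refine measureReal_iUnion_le_of_sum_range_le fun N =>
    sum_range_le_tailConst hL ht htL hδ (fun _ => rfl) (fun j => ?_) (fun j => ?_) N
  · set u := Real.exp (-((j : ℝ) * δ * δ + δ ^ 2 / 2) / 2) with hu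
    have h := measureReal_coordCount_lt_le (ι := Fin n) (gaussianReal 0 1) (hA j) (hB j)
      (u := u) (Real.exp_pos _) ?_ ?_
    · rw [hn, ← hpA j]
      rw [Fintype.card_fin] at h
      exact h
    · rw [hu, Real.exp_le_one_iff]
      have : 0 ≤ (j : ℝ) * δ * δ := by positivity
      linarith [sq_nonneg δ]
    · rw [hpA, hpB, hu, ← Real.exp_nat_mul]
      convert gaussianTail_add_le (j * δ) hδ0 using 2
      · ring
      · congr 1
        push_cast
        ring
  · rw [hn, ← hpB j]
    have h := measureReal_exists_mem_le (ι := Fin n) (gaussianReal 0 1) (hB j)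
    rw [Fintype.card_fin] at h
    refine le_trans ?_ h
    have hprod : ((stdGaussian n).prod (stdGaussian n)).real
        (univ ×ˢ {x | ∃ i, x i ∈ B j}) = (stdGaussian n).real {x | ∃ i, x i ∈ B j} := by
      rw [measureReal_prod_prod, probReal_univ, one_mul]
    refine le_trans (measureReal_mono ?_) hprod.le
    intro xy hxy
    exact ⟨mem_univ _, exists_mem_of_coordCount_pos (Nat.zero_lt_of_lt hxy)⟩

lemma measureReal_exists_sortVec_lt_le {n : ℕ} {t δ : ℝ} (hL : 1 ≤ Real.log n) (ht : 1 ≤ t)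
    (htL : t ^ 2 ≤ Real.log n) (hδ : δ = 4 * t ^ 2 / √(Real.log n)) :
    ((stdGaussian n).prod (stdGaussian n)).real
      {xy | ∃ i, sortVec xy.1 i + 2 * δ < sortVec xy.2 i} ≤
      2 * tailConst * Real.exp (-t ^ 2) := by
  have hs : 0 < √(Real.log n) := Real.sqrt_pos.mpr (by linarith)
  have hδ0 : 0 < δ := by rw [hδ]; positivity
  have h1 := measureReal_exists_coordCount_lt_le hL ht htL hδ
    (A := fun j => Ioi (j * δ)) (B := fun j => Ioi ((j + 1) * δ))
    (fun _ => measurableSet_Ioi) (fun _ => measurableSet_Ioi) (fun _ => rfl) (fun _ => rfl)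
  have h2 := measureReal_exists_coordCount_lt_le hL ht htL hδ
    (A := fun j => Iic (-(j * δ))) (B := fun j => Iic (-((j + 1) * δ)))
    (fun _ => measurableSet_Iic) (fun _ => measurableSet_Iic)
    (fun _ => gaussianReal_real_Iic_neg _) (fun _ => gaussianReal_real_Iic_neg _)
  rw [← measureReal_prod_swap (_root_.stdGaussian n) (fun x y => ∃ j : ℕ,
    coordCount (Iic (-(j * δ))) x < coordCount (Iic (-((j + 1) * δ))) y)] at h2
  refine (measureReal_mono ?_).trans
    ((measureReal_union_le _ _).trans ((add_le_add h1 h2).trans_eq (by ring)))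
  intro xy hxy
  obtain ⟨j, h | h⟩ := exists_coordCount_lt_of_sortVec hδ0 hxy
  · exact Or.inl ⟨j, h⟩
  · exact Or.inr ⟨j, h⟩

lemma measureReal_exists_sortVec_abs_sub_gt_le {n : ℕ} {t : ℝ} (hL : 1 ≤ Real.log n)
    (ht : 1 ≤ t) (htL : t ^ 2 ≤ Real.log n) :
    ((stdGaussian n).prod (stdGaussian n)).real
      {xy | ∃ i, 8 * (t ^ 2 / √(Real.log n)) < |sortVec xy.1 i - sortVec xy.2 i|} ≤
      4 * tailConst * Real.exp (-t ^ 2) := by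
  have h1 := measureReal_exists_sortVec_lt_le hL ht htL rfl
  have h2 := h1
  rw [← measureReal_prod_swap (_root_.stdGaussian n) (fun x y => ∃ i,
    sortVec x i + 2 * (4 * t ^ 2 / √(Real.log n)) < sortVec y i)] at h2
  refine (measureReal_mono ?_).trans
    ((measureReal_union_le _ _).trans ((add_le_add h1 h2).trans_eq (by ring)))
  rintro xy ⟨i, hi⟩
  have he : 8 * (t ^ 2 / √(Real.log n)) = 2 * (4 * t ^ 2 / √(Real.log n)) := by ring
  rw [he] at hi
  rcases lt_abs.mp hi with h | h
  · exact Or.inr ⟨i, by linarith⟩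
  · exact Or.inl ⟨i, by linarith⟩

lemma measureReal_exists_sortVec_abs_sub_gt_le_of_large {n : ℕ} {t : ℝ} (hn : 0 < n)
    (ht : 0 ≤ t) (htL : Real.log n ≤ t ^ 2) :
    ((stdGaussian n).prod (stdGaussian n)).real
      {xy | ∃ i, 4 * t < |sortVec xy.1 i - sortVec xy.2 i|} ≤ 4 * Real.exp (-t ^ 2) := by
  set S : Set (Fin n → ℝ) := {x | ∃ i, x i ∈ Iic (-(2 * t)) ∪ Ioi (2 * t)} with hS
  have hQ : (gaussianReal 0 1).real (Iic (-(2 * t)) ∪ Ioi (2 * t)) ≤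
      2 * Real.exp (-(2 * t ^ 2)) := by
    have h := gaussianTail_le (show 0 ≤ 2 * t by positivity)
    have h2 : (2 * t) ^ 2 / 2 = 2 * t ^ 2 := by ring
    rw [h2] at h
    refine (measureReal_union_le _ _).trans ?_
    rw [gaussianReal_real_Iic_neg, ← gaussianTail]
    linarith
  have hn' : (n : ℝ) ≤ Real.exp (t ^ 2) := by
    rwa [← Real.log_le_iff_le_exp (by exact_mod_cast hn)]
  have hSle : (stdGaussian n).real S ≤ 2 * Real.exp (-t ^ 2) := by
    have h := measureReal_exists_mem_le (ι := Fin n) (gaussianReal 0 1)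
      (B := Iic (-(2 * t)) ∪ Ioi (2 * t)) (measurableSet_Iic.union measurableSet_Ioi)
    rw [Fintype.card_fin] at h
    calc (stdGaussian n).real S ≤ n * (gaussianReal 0 1).real (Iic (-(2 * t)) ∪ Ioi (2 * t)) := h
      _ ≤ Real.exp (t ^ 2) * (2 * Real.exp (-(2 * t ^ 2))) := by gcongr
      _ = 2 * Real.exp (-t ^ 2) := by
        rw [mul_left_comm, ← Real.exp_add]
        congr 2
        ring
  have h1 : ((stdGaussian n).prod (stdGaussian n)).real {xy | xy.2 ∈ S} ≤
      2 * Real.exp (-t ^ 2) := by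
    rw [show {xy : (Fin n → ℝ) × (Fin n → ℝ) | xy.2 ∈ S} = univ ×ˢ S by ext; simp,
      measureReal_prod_prod, probReal_univ, one_mul]
    exact hSle
  have h2 := h1
  rw [measureReal_prod_swap (_root_.stdGaussian n) (fun x _ => x ∈ S)] at h2
  refine (measureReal_mono ?_).trans
    ((measureReal_union_le _ _).trans ((add_le_add h1 h2).trans_eq (by ring)))
  rintro xy ⟨i, hi⟩
  by_contra hc
  simp only [hS, mem_union, mem_ofPred_eq, mem_Iic, mem_Ioi, not_or, not_exists, not_le,
    not_lt] at hc
  have hx := hc.2 (Tuple.sort xy.1 i)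
  have hy := hc.1 (Tuple.sort xy.2 i)
  refine hi.not_ge (abs_le.mpr ⟨?_, ?_⟩) <;> unfold sortVec <;> linarith

end Probability

/-- There exists a universal constant `C > 0` such that for every `n ≥ 3` and `t ≥ 0`,
if `X, Y` are independent standard Gaussians in `ℝ^n` and `T` sorts coordinates in
non-decreasing order, then with probability at least `1 - C exp(-t²)`:
`‖TX - TY‖_∞ ≤ C min{t²/√(ln n), t}`. -/
theorem sorted_gaussian_linfty_bound :
    ∃ C : ℝ, 0 < C ∧
      ∀ (n : ℕ) (t : ℝ), 3 ≤ n → 0 ≤ t →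
        1 - C * Real.exp (-t ^ 2) ≤
          (((stdGaussian n).prod (stdGaussian n))
            {xy | ∀ i : Fin n, |sortVec xy.1 i - sortVec xy.2 i| ≤
              C * min (t ^ 2 / Real.sqrt (Real.log n)) t}).toReal := by
  have hC24 : 24 ≤ tailConst := by
    have := Real.exp_pos 12288
    unfold tailConst
    linarith
  refine ⟨4 * tailConst, by linarith, fun n t hn ht => ?_⟩
  have hexp := Real.exp_pos (-t ^ 2)
  have hL : 1 ≤ Real.log n := by
    rw [Real.le_log_iff_exp_le (by positivity)]
    have h3 : (3 : ℝ) ≤ n := by exact_mod_cast hn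
    linarith [Real.exp_one_lt_d9]
  have hs : 0 < √(Real.log n) := Real.sqrt_pos.mpr (by linarith)
  have hs2 : √(Real.log n) ^ 2 = Real.log n := Real.sq_sqrt (by linarith)
  rw [← measureReal_def]
  rcases lt_or_ge t 1 with ht1 | ht1
  · refine le_trans ?_ measureReal_nonneg
    have h1 : Real.exp (-1) ≤ Real.exp (-t ^ 2) := by
      gcongr
      exact pow_le_one₀ ht ht1.le
    have h2 : (1 : ℝ) / 3 ≤ Real.exp (-1) := by
      rw [Real.exp_neg, one_div]
      exact inv_anti₀ (Real.exp_pos 1) (by linarith [Real.exp_one_lt_d9])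
    nlinarith
  have key : ∀ r : ℝ, r ≤ 4 * tailConst * min (t ^ 2 / √(Real.log n)) t →
      ((stdGaussian n).prod (stdGaussian n)).real
        {xy | ∃ i, r < |sortVec xy.1 i - sortVec xy.2 i|} ≤
        4 * tailConst * Real.exp (-t ^ 2) →
      1 - 4 * tailConst * Real.exp (-t ^ 2) ≤
        ((stdGaussian n).prod (stdGaussian n)).real
          {xy | ∀ i : Fin n, |sortVec xy.1 i - sortVec xy.2 i| ≤
            4 * tailConst * min (t ^ 2 / √(Real.log n)) t} := by
    intro r hr hbad
    set μ := (_root_.stdGaussian n).prod (_root_.stdGaussian n)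
    have huniv : μ.real univ = 1 := probReal_univ
    have hcover := (measureReal_mono (μ := μ) (s₁ := univ)
      (s₂ := {xy | ∀ i : Fin n, |sortVec xy.1 i - sortVec xy.2 i| ≤
            4 * tailConst * min (t ^ 2 / √(Real.log n)) t} ∪
        {xy | ∃ i, r < |sortVec xy.1 i - sortVec xy.2 i|}) (by
          intro xy _
          by_cases h : ∃ i, r < |sortVec xy.1 i - sortVec xy.2 i|
          · exact Or.inr h
          · push Not at h
            exact Or.inl fun i => (h i).trans hr)).trans (measureReal_union_le _ _)
    linarith
  rcases le_total (t ^ 2) (Real.log n) with h | h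
  · have hts : t ≤ √(Real.log n) := Real.le_sqrt_of_sq_le h
    have hmin : min (t ^ 2 / √(Real.log n)) t = t ^ 2 / √(Real.log n) := by
      refine min_eq_left ?_
      rw [div_le_iff₀ hs]
      nlinarith
    refine key _ ?_ (measureReal_exists_sortVec_abs_sub_gt_le hL ht1 h)
    rw [hmin]
    gcongr
    linarith
  · have hts : √(Real.log n) ≤ t := Real.sqrt_le_iff.mpr ⟨ht, h⟩
    have hmin : min (t ^ 2 / √(Real.log n)) t = t := by
      refine min_eq_right ?_
      rw [le_div_iff₀ hs]
      nlinarith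
    refine key (4 * t) ?_
      ((measureReal_exists_sortVec_abs_sub_gt_le_of_large (by omega) ht h).trans ?_)
    · rw [hmin]
      gcongr
      linarith
    · gcongr
      linarith
end

section
/- There exists a universal constant C > 0 such that the following holds (Case I). Let n ≥ 3, t > 0, r ∈ [0,∞), p ∈ [3/2,∞), and let X be a random vector in ℝ^n with the standard normal distribution. Define A = C^p·p^p·n^{1-2r}·(ln n)^p/[p + (1-2r)·ln n]^p if 0 ≤ r ≤ 1/2, and A = C^p·(ln n)^p/(1 + (2r-1)·ln n) + C^p·(ln n)^{p-1} if r > 1/2; define B = C·[1 + (ln n/(1 + |2-2r-p|·ln n))^{2-p}·(1 + n^{2-2r-p})] if 3/2 ≤ p < 2, and B = C^p if p ≥ 2. Then with probability at least 1 − C·exp(−t²/2): ∑_{i=1}^{n} i^{-2r}·X_[i]^{2(p-1)} ≤ A + B·t^{2(p-1)}. -/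
open MeasureTheory ProbabilityTheory

/-- `decRe x` is the non-increasing rearrangement of `(|x_1|, …, |x_n|)`
(indexed from `0`, so `decRe x i = x_[i+1]` in the paper's notation). -/
noncomputable def decRe {n : ℕ} (x : Fin n → ℝ) : Fin n → ℝ :=
  fun i => |x (Tuple.sort (fun j => |x j|) i.rev)|

/-! ### Power sums -/

lemma sum_rpow_sub_one_le {σ : ℝ} (hσ : 0 < σ) (hσ1 : σ ≤ 1) (n : ℕ) :
    ∑ i ∈ Finset.range n, ((i : ℝ) + 1) ^ (σ - 1) ≤ (n : ℝ) ^ σ / σ := by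
  induction n with
  | zero => simp [Real.zero_rpow hσ.ne']
  | succ n ih =>
    rw [Finset.sum_range_succ]
    push_cast
    have hn : (0 : ℝ) < (n : ℝ) + 1 := by positivity
    have hle : 1 / ((n : ℝ) + 1) ≤ 1 := by
      rw [div_le_one hn]
      linarith [(Nat.cast_nonneg n : (0 : ℝ) ≤ n)]
    have hb := rpow_one_add_le_one_add_mul_self (s := -(1 / ((n : ℝ) + 1))) (by linarith) hσ.le hσ1
    have e1 : (n : ℝ) ^ σ = ((n : ℝ) + 1) ^ σ * (1 + -(1 / ((n : ℝ) + 1))) ^ σ := by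
      rw [← Real.mul_rpow hn.le (by linarith)]
      congr 1
      field_simp
      ring
    have e2 : ((n : ℝ) + 1) ^ (σ - 1) = ((n : ℝ) + 1) ^ σ / ((n : ℝ) + 1) :=
      Real.rpow_sub_one hn.ne' σ
    have hpos : 0 < ((n : ℝ) + 1) ^ σ := Real.rpow_pos_of_pos hn σ
    have h1 : (n : ℝ) ^ σ ≤ ((n : ℝ) + 1) ^ σ - σ * (((n : ℝ) + 1) ^ σ / ((n : ℝ) + 1)) := by
      rw [e1]
      calc _ ≤ ((n : ℝ) + 1) ^ σ * (1 + σ * -(1 / ((n : ℝ) + 1))) := by gcongr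
        _ = _ := by ring
    rw [e2]
    have h2 : (n : ℝ) ^ σ / σ ≤
        (((n : ℝ) + 1) ^ σ - σ * (((n : ℝ) + 1) ^ σ / ((n : ℝ) + 1))) / σ := by gcongr
    rw [sub_div, mul_div_cancel_left₀ _ hσ.ne'] at h2
    linarith

lemma one_add_mul_le_rpow_neg {s x : ℝ} (hs : 0 ≤ s) (hx : 0 < x) :
    1 + s * (1 - x) ≤ x ^ (-s) := by
  have h1 := Real.add_one_le_exp (-s * Real.log x)
  have h2 := Real.log_le_sub_one_of_pos hx
  have h3 : x ^ (-s) = Real.exp (-s * Real.log x) := by rw [Real.rpow_def_of_pos hx, mul_comm]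
  nlinarith

lemma sum_rpow_neg_one_sub_le {s : ℝ} (hs : 0 < s) (n : ℕ) :
    ∑ i ∈ Finset.range (n + 1), ((i : ℝ) + 1) ^ (-1 - s) ≤
      1 + (1 - ((n : ℝ) + 1) ^ (-s)) / s := by
  induction n with
  | zero => simp
  | succ n ih =>
    rw [Finset.sum_range_succ]
    push_cast
    set m : ℝ := (n : ℝ) + 1 with hm
    have hm0 : 0 < m := by positivity
    have hb := one_add_mul_le_rpow_neg hs.le (x := m / (m + 1)) (by positivity)
    have e1 : m ^ (-s) = (m + 1) ^ (-s) * (m / (m + 1)) ^ (-s) := by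
      rw [← Real.mul_rpow (by positivity) (by positivity)]
      congr 1
      field_simp
    have e2 : (m + 1) ^ (-1 - s) = (m + 1) ^ (-s) / (m + 1) := by
      rw [show -1 - s = -s - 1 by ring, Real.rpow_sub_one (by positivity)]
    have hpos : 0 < (m + 1) ^ (-s) := Real.rpow_pos_of_pos (by positivity) _
    have h1 : (m + 1) ^ (-s) + s * ((m + 1) ^ (-s) / (m + 1)) ≤ m ^ (-s) := by
      rw [e1]
      calc _ = (m + 1) ^ (-s) * (1 + s * (1 - m / (m + 1))) := by field_simp; ring
        _ ≤ _ := by gcongr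
    rw [e2]
    have h2 : (1 - m ^ (-s)) / s ≤
        (1 - ((m + 1) ^ (-s) + s * ((m + 1) ^ (-s) / (m + 1)))) / s := by gcongr
    rw [← sub_sub, sub_div (1 - (m + 1) ^ (-s)), mul_div_cancel_left₀ _ hs.ne'] at h2
    linarith

lemma sum_inv_le_one_add_log (n : ℕ) :
    ∑ i ∈ Finset.range n, ((i : ℝ) + 1)⁻¹ ≤ 1 + Real.log n := by
  have h := harmonic_le_one_add_log n
  simpa [harmonic] using h

lemma one_le_log_of_three_le {n : ℕ} (hn : 3 ≤ n) : 1 ≤ Real.log n := by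
  have h3 : (3 : ℝ) ≤ n := by exact_mod_cast hn
  rw [Real.le_log_iff_exp_le (by linarith)]
  linarith [Real.exp_one_lt_d9]

lemma le_two_mul_div_one_add_mul {x L s : ℝ} (hL : 0 < L) (hs : 0 ≤ s) (h1 : x ≤ L)
    (h2 : s * x ≤ 1) : x ≤ 2 * (L / (1 + s * L)) := by
  rw [← mul_div_assoc, le_div_iff₀ (by positivity)]
  nlinarith

/-- Power sums with exponent at least `-1`. -/
lemma sum_rpow_sub_one_le_log {n : ℕ} (hn : 3 ≤ n) {σ : ℝ} (hσ : 0 ≤ σ) (hσ1 : σ ≤ 1) :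
    ∑ i ∈ Finset.range n, ((i : ℝ) + 1) ^ (σ - 1) ≤
      4 * (n : ℝ) ^ σ * (Real.log n / (1 + σ * Real.log n)) := by
  have hL := one_le_log_of_three_le hn
  have hn0 : (0 : ℝ) < n := by positivity
  have hnσ : 0 < (n : ℝ) ^ σ := Real.rpow_pos_of_pos hn0 σ
  have h1 : ∑ i ∈ Finset.range n, ((i : ℝ) + 1) ^ (σ - 1) ≤ (n : ℝ) ^ σ * (2 * Real.log n) := by
    calc _ ≤ ∑ i ∈ Finset.range n, (n : ℝ) ^ σ * ((i : ℝ) + 1)⁻¹ := by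
          refine Finset.sum_le_sum fun i hi => ?_
          have hi' : (i : ℝ) + 1 ≤ n := by exact_mod_cast Finset.mem_range.1 hi
          rw [Real.rpow_sub_one (by positivity), div_eq_mul_inv]
          gcongr
      _ = (n : ℝ) ^ σ * ∑ i ∈ Finset.range n, ((i : ℝ) + 1)⁻¹ := by rw [Finset.mul_sum]
      _ ≤ _ := by
          gcongr
          linarith [sum_inv_le_one_add_log n]
  have h2 : σ * ∑ i ∈ Finset.range n, ((i : ℝ) + 1) ^ (σ - 1) ≤ (n : ℝ) ^ σ := by
    rcases hσ.eq_or_lt with h | h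
    · rw [← h]; simp
    · have := sum_rpow_sub_one_le h hσ1 n
      rw [le_div_iff₀ h] at this
      linarith
  set S := ∑ i ∈ Finset.range n, ((i : ℝ) + 1) ^ (σ - 1)
  have h3 := le_two_mul_div_one_add_mul (x := S / (n : ℝ) ^ σ / 2) (L := Real.log n) (s := σ)
    (by linarith) hσ (by rw [div_div, div_le_iff₀ (by positivity)]; linarith)
    (by rw [div_div, ← mul_div_assoc, div_le_one (by positivity)]; linarith)
  rw [div_div, div_le_iff₀ (by positivity)] at h3
  linarith

/-- Power sums with exponent at most `-1`. -/
lemma sum_rpow_neg_one_sub_le_log {n : ℕ} (hn : 3 ≤ n) {s : ℝ} (hs : 0 ≤ s) :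
    ∑ i ∈ Finset.range n, ((i : ℝ) + 1) ^ (-1 - s) ≤
      1 + 2 * (Real.log n / (1 + s * Real.log n)) := by
  have hL := one_le_log_of_three_le hn
  have h1 : ∑ i ∈ Finset.range n, ((i : ℝ) + 1) ^ (-1 - s) ≤ 1 + Real.log n := by
    refine le_trans (Finset.sum_le_sum fun i _ => ?_) (sum_inv_le_one_add_log n)
    rw [← Real.rpow_neg_one]
    exact Real.rpow_le_rpow_of_exponent_le (by linarith [(Nat.cast_nonneg i : (0 : ℝ) ≤ i)])
      (by linarith)
  have h2 : s * (∑ i ∈ Finset.range n, ((i : ℝ) + 1) ^ (-1 - s) - 1) ≤ 1 := by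
    rcases hs.eq_or_lt with h | h
    · rw [← h]; simp
    · obtain ⟨m, rfl⟩ : ∃ m, n = m + 1 := ⟨n - 1, by omega⟩
      have := sum_rpow_neg_one_sub_le h m
      have hp : 0 < ((m : ℝ) + 1) ^ (-s) := Real.rpow_pos_of_pos (by positivity) _
      have h4 : (1 - ((m : ℝ) + 1) ^ (-s)) / s ≤ 1 / s := by gcongr; linarith
      have h5 : s * (1 / s) = 1 := by field_simp
      nlinarith
  linarith [le_two_mul_div_one_add_mul (L := Real.log n) (s := s) (by linarith) hs
    (sub_le_iff_le_add'.2 h1) h2]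

/-! ### The typical size of the sum -/

lemma log_exp_mul_div_bounds {n i : ℕ} (hi : i < n) :
    1 ≤ Real.log (Real.exp 1 * n / (i + 1)) ∧
      Real.log (Real.exp 1 * n / (i + 1)) ≤ 1 + Real.log n := by
  have hi' : (i : ℝ) + 1 ≤ n := by exact_mod_cast hi
  have hi0 : (0 : ℝ) < (i : ℝ) + 1 := by positivity
  have hn0 : (0 : ℝ) < n := by linarith
  rw [Real.log_div (by positivity) hi0.ne', Real.log_mul (by positivity) hn0.ne', Real.log_exp]
  have h1 := Real.log_le_log hi0 hi'
  have h2 : 0 ≤ Real.log ((i : ℝ) + 1) :=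
    Real.log_nonneg (by linarith [(Nat.cast_nonneg i : (0 : ℝ) ≤ i)])
  constructor <;> linarith

lemma sum_log_rpow_le_of_half_lt {n : ℕ} (hn : 3 ≤ n) {r p : ℝ} (hr : 1 / 2 < r)
    (hp : 3 / 2 ≤ p) :
    ∑ i ∈ Finset.range n, ((i : ℝ) + 1) ^ (-(2 * r)) *
        (24 * Real.log (Real.exp 1 * n / (i + 1))) ^ (p - 1) ≤
      (100 : ℝ) ^ p * Real.log n ^ p / (1 + (2 * r - 1) * Real.log n) +
        (100 : ℝ) ^ p * Real.log n ^ (p - 1) := by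
  have hL := one_le_log_of_three_le hn
  have hL0 : 0 < Real.log n := by linarith
  have hs := sum_rpow_neg_one_sub_le_log hn (s := 2 * r - 1) (by linarith)
  rw [show -1 - (2 * r - 1) = -(2 * r) by ring] at hs
  calc _ ≤ ∑ i ∈ Finset.range n, ((i : ℝ) + 1) ^ (-(2 * r)) * (48 * Real.log n) ^ (p - 1) := by
        refine Finset.sum_le_sum fun i hi => ?_
        have := log_exp_mul_div_bounds (Finset.mem_range.1 hi)
        gcongr ?_ * ?_
        exact Real.rpow_le_rpow (by linarith) (by linarith) (by linarith)
    _ = (∑ i ∈ Finset.range n, ((i : ℝ) + 1) ^ (-(2 * r))) * (48 * Real.log n) ^ (p - 1) := by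
        rw [Finset.sum_mul]
    _ ≤ (1 + 2 * (Real.log n / (1 + (2 * r - 1) * Real.log n))) *
          (48 * Real.log n) ^ (p - 1) := by gcongr
    _ = 48 ^ (p - 1) * Real.log n ^ (p - 1) + 2 * 48 ^ (p - 1) *
          (Real.log n ^ p / (1 + (2 * r - 1) * Real.log n)) := by
        rw [Real.mul_rpow (by norm_num) hL0.le, Real.rpow_sub_one hL0.ne' p]
        field_simp
    _ ≤ 100 ^ p * Real.log n ^ (p - 1) + 100 ^ p *
          (Real.log n ^ p / (1 + (2 * r - 1) * Real.log n)) := by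
        have h0 : (0 : ℝ) < 48 ^ (p - 1) := by positivity
        have h48 : 2 * (48 : ℝ) ^ (p - 1) ≤ 100 ^ p := by
          calc 2 * (48 : ℝ) ^ (p - 1) ≤ 48 ^ p := by
                rw [Real.rpow_sub_one (by norm_num)]
                have : (0 : ℝ) < 48 ^ p := by positivity
                linarith
            _ ≤ 100 ^ p := Real.rpow_le_rpow (by norm_num) (by norm_num) (by linarith)
        have hr' : 0 < 2 * r - 1 := by linarith
        gcongr
        linarith
    _ = _ := by ring

lemma sum_log_rpow_le_of_le_half {n : ℕ} (hn : 3 ≤ n) {r p : ℝ} (hr0 : 0 ≤ r)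
    (hr : r ≤ 1 / 2) (hp : 3 / 2 ≤ p) :
    ∑ i ∈ Finset.range n, ((i : ℝ) + 1) ^ (-(2 * r)) *
        (24 * Real.log (Real.exp 1 * n / (i + 1))) ^ (p - 1) ≤
      (100 : ℝ) ^ p * p ^ p * (n : ℝ) ^ (1 - 2 * r) * Real.log n ^ p /
        (p + (1 - 2 * r) * Real.log n) ^ p := by
  have hL := one_le_log_of_three_le hn
  have hL0 : 0 < Real.log n := by linarith
  have hp0 : 0 < p := by linarith
  have hn0 : (0 : ℝ) < n := by positivity
  obtain ⟨s, rfl⟩ : ∃ s, r = (1 - s) / 2 := ⟨1 - 2 * r, by ring⟩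
  have hs0 : 0 ≤ s := by linarith
  have hs1 : s ≤ 1 := by linarith
  rw [show 1 - 2 * ((1 - s) / 2) = s by ring, show -(2 * ((1 - s) / 2)) = s - 1 by ring]
  have hns : 0 < (n : ℝ) ^ s := by positivity
  have key : ∀ M : ℝ, 0 < M → M * (p + s * Real.log n) ≤ 100 * p * Real.log n →
      (n : ℝ) ^ s * M ^ p ≤
      (100 : ℝ) ^ p * p ^ p * (n : ℝ) ^ s * Real.log n ^ p / (p + s * Real.log n) ^ p := by
    intro M hM h
    rw [le_div_iff₀ (by positivity)]
    have := Real.rpow_le_rpow (by positivity) h hp0.le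
    rw [Real.mul_rpow hM.le (by positivity), Real.mul_rpow (by positivity) hL0.le,
      Real.mul_rpow (by norm_num) hp0.le] at this
    nlinarith
  rcases le_or_gt (s * Real.log n) p with hc | hc
  · have hsum := sum_rpow_sub_one_le_log hn hs0 hs1
    have hfrac : Real.log n / (1 + s * Real.log n) ≤ Real.log n :=
      div_le_self hL0.le (by nlinarith)
    calc _ ≤ ∑ i ∈ Finset.range n, ((i : ℝ) + 1) ^ (s - 1) * (48 * Real.log n) ^ (p - 1) := by
          refine Finset.sum_le_sum fun i hi => ?_
          have := log_exp_mul_div_bounds (Finset.mem_range.1 hi)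
          gcongr ?_ * ?_
          exact Real.rpow_le_rpow (by linarith) (by linarith) (by linarith)
      _ = (∑ i ∈ Finset.range n, ((i : ℝ) + 1) ^ (s - 1)) * (48 * Real.log n) ^ (p - 1) := by
          rw [Finset.sum_mul]
      _ ≤ (4 * (n : ℝ) ^ s * Real.log n) * (48 * Real.log n) ^ (p - 1) := by
          gcongr
          exact hsum.trans (by gcongr)
      _ = (n : ℝ) ^ s * (48 * Real.log n) ^ p / 12 := by
          rw [Real.rpow_sub_one (by positivity)]
          field_simp
          norm_num
      _ ≤ (n : ℝ) ^ s * (48 * Real.log n) ^ p := by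
          have : 0 < (n : ℝ) ^ s * (48 * Real.log n) ^ p := by positivity
          linarith
      _ ≤ _ := key _ (by positivity) (by nlinarith)
  · have hs : 0 < s := by
      by_contra h
      have : s = 0 := by linarith
      rw [this] at hc
      linarith
    have hq : 0 < p - 1 := by linarith
    set M : ℝ := 24 * ((p - 1) / (s / 2)) with hM
    have hM0 : 0 < M := by positivity
    have hterm : ∀ i ∈ Finset.range n, ((i : ℝ) + 1) ^ (s - 1) *
        (24 * Real.log (Real.exp 1 * n / (i + 1))) ^ (p - 1) ≤
        ((i : ℝ) + 1) ^ (s / 2 - 1) * (M ^ (p - 1) * (2 * (n : ℝ) ^ (s / 2))) := by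
      intro i hi
      have hb := log_exp_mul_div_bounds (Finset.mem_range.1 hi)
      have hx : 0 < Real.exp 1 * n / ((i : ℝ) + 1) := by positivity
      have hlog := Real.log_le_rpow_div hx.le (ε := s / 2 / (p - 1)) (by positivity)
      have he : Real.exp 1 ^ (s / 2) ≤ 2 := by
        have h1 : Real.exp 1 ^ (s / 2) ≤ Real.exp 1 ^ (1 / 2 : ℝ) :=
          Real.rpow_le_rpow_of_exponent_le (by linarith [Real.add_one_le_exp (1 : ℝ)])
            (by linarith)
        have h2 : (Real.exp 1 ^ (1 / 2 : ℝ)) ≤ 2 := by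
          rw [← Real.sqrt_eq_rpow, Real.sqrt_le_left (by norm_num)]
          linarith [Real.exp_one_lt_d9]
        linarith
      have h1 : (24 * Real.log (Real.exp 1 * n / (i + 1))) ^ (p - 1) ≤
          M ^ (p - 1) * (Real.exp 1 * n / ((i : ℝ) + 1)) ^ (s / 2) := by
        calc _ ≤ (M * (Real.exp 1 * n / ((i : ℝ) + 1)) ^ (s / 2 / (p - 1))) ^ (p - 1) := by
              refine Real.rpow_le_rpow (by linarith) ?_ hq.le
              calc _ ≤ 24 * ((Real.exp 1 * n / ((i : ℝ) + 1)) ^ (s / 2 / (p - 1)) /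
                      (s / 2 / (p - 1))) := by gcongr
                _ = _ := by rw [hM]; field_simp
          _ = _ := by
              rw [Real.mul_rpow hM0.le (by positivity), ← Real.rpow_mul hx.le,
                div_mul_cancel₀ _ hq.ne']
      calc _ ≤ ((i : ℝ) + 1) ^ (s - 1) *
            (M ^ (p - 1) * (Real.exp 1 * n / ((i : ℝ) + 1)) ^ (s / 2)) := by gcongr
        _ = ((i : ℝ) + 1) ^ (s / 2 - 1) * (M ^ (p - 1) *
            (Real.exp 1 ^ (s / 2) * (n : ℝ) ^ (s / 2))) := by
            rw [Real.div_rpow (by positivity) (by positivity),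
              Real.mul_rpow (by positivity) hn0.le,
              show s - 1 = (s / 2 - 1) + s / 2 by ring, Real.rpow_add (by positivity)]
            field_simp
        _ ≤ _ := by gcongr
    calc _ ≤ _ := Finset.sum_le_sum hterm
      _ = (∑ i ∈ Finset.range n, ((i : ℝ) + 1) ^ (s / 2 - 1)) *
            (M ^ (p - 1) * (2 * (n : ℝ) ^ (s / 2))) := by rw [Finset.sum_mul]
      _ ≤ ((n : ℝ) ^ (s / 2) / (s / 2)) * (M ^ (p - 1) * (2 * (n : ℝ) ^ (s / 2))) := by
          gcongr
          exact sum_rpow_sub_one_le (by linarith) (by linarith) n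
      _ = (n : ℝ) ^ s * (M ^ (p - 1) * (4 / s)) := by
          rw [show (n : ℝ) ^ s = (n : ℝ) ^ (s / 2) * (n : ℝ) ^ (s / 2) by
            rw [← Real.rpow_add hn0]; ring_nf]
          field_simp
          norm_num
      _ ≤ (n : ℝ) ^ s * (48 * p / s) ^ p := by
          gcongr
          rw [show (48 * p / s) ^ p = (48 * p / s) ^ (p - 1) * (48 * p / s) by
            rw [Real.rpow_sub_one (by positivity)]; field_simp]
          have h1 : M ≤ 48 * p / s := by
            rw [hM, le_div_iff₀ hs]
            field_simp
            linarith
          gcongr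
          linarith
      _ ≤ _ := key _ (by positivity) (by
          rw [div_mul_eq_mul_div, div_le_iff₀ hs]
          nlinarith [mul_pos hp0 (mul_pos hs hL0)])

/-! ### The size of the deviation -/

lemma sum_rpow_le_rpow_sum {ι : Type*} (J : Finset ι) {f : ι → ℝ} (hf : ∀ i, 0 ≤ f i) {q : ℝ}
    (hq : 1 ≤ q) : ∑ i ∈ J, f i ^ q ≤ (∑ i ∈ J, f i) ^ q := by
  classical
  induction J using Finset.induction_on with
  | empty => simp [Real.zero_rpow (by linarith : q ≠ 0)]
  | insert a J ha ih =>
    rw [Finset.sum_insert ha, Finset.sum_insert ha]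
    exact (add_le_add_right ih _).trans
      (Real.add_rpow_le_rpow_add (hf a) (Finset.sum_nonneg fun i _ => hf i) hq)

lemma sum_mul_rpow_le_holder {ι : Type*} (J : Finset ι) {w f : ι → ℝ} (hw : ∀ i, 0 ≤ w i)
    (hf : ∀ i, 0 ≤ f i) {q : ℝ} (hq : 0 < q) (hq1 : q < 1) :
    ∑ i ∈ J, w i * f i ^ q ≤ (∑ i ∈ J, w i ^ (1 - q)⁻¹) ^ (1 - q) * (∑ i ∈ J, f i) ^ q := by
  have hc : ((1 - q)⁻¹).HolderConjugate q⁻¹ := by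
    rw [Real.holderConjugate_iff]
    refine ⟨(one_lt_inv₀ (by linarith)).2 (by linarith), ?_⟩
    simp
  have h := Real.inner_le_Lp_mul_Lq_of_nonneg J hc (f := w) (g := fun i => f i ^ q)
    (fun i _ => hw i) (fun i _ => Real.rpow_nonneg (hf i) q)
  simpa [Real.rpow_rpow_inv (hf _) hq.ne'] using h

lemma sum_rpow_rpow_le {n : ℕ} (hn : 3 ≤ n) {r p : ℝ} (hr : 0 ≤ r) (hp : 3 / 2 ≤ p)
    (hp2 : p < 2) :
    (∑ i ∈ Finset.range n, ((i : ℝ) + 1) ^ (-(2 * r / (2 - p)))) ^ (2 - p) ≤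
      4 * (1 + (Real.log n / (1 + |2 - 2 * r - p| * Real.log n)) ^ (2 - p) *
        (1 + (n : ℝ) ^ (2 - 2 * r - p))) := by
  have hL := one_le_log_of_three_le hn
  have hL0 : 0 < Real.log n := by linarith
  have hn0 : (0 : ℝ) < n := by positivity
  have hq : 0 < 2 - p := by linarith
  set q := 2 - p with hqdef
  have hq1 : q ≤ 1 := by linarith
  rw [show 2 - 2 * r - p = q - 2 * r by ring]
  set d := q - 2 * r with hd
  have hfrac : ∀ σ : ℝ, |d| ≤ σ →
      Real.log n / (1 + σ * Real.log n) ≤ Real.log n / (1 + |d| * Real.log n) := by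
    intro σ h
    gcongr
  set K := Real.log n / (1 + |d| * Real.log n) with hK
  have hK0 : 0 < K := by positivity
  have hKq : 0 < K ^ q := by positivity
  have hnd : 0 < (n : ℝ) ^ d := by positivity
  have hS0 : 0 ≤ ∑ i ∈ Finset.range n, ((i : ℝ) + 1) ^ (-(2 * r / q)) :=
    Finset.sum_nonneg fun i _ => by positivity
  have hc : ∀ c : ℝ, 1 ≤ c → c ^ q ≤ c := fun c hc => by
    simpa using Real.rpow_le_rpow_of_exponent_le hc hq1
  have habs : |d| ≤ |d| / q := le_div_self (abs_nonneg d) hq hq1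
  rcases le_or_gt 0 d with h | h
  · rw [abs_of_nonneg h] at habs
    have h1 := sum_rpow_sub_one_le_log hn (σ := d / q) (by positivity)
      ((div_le_one hq).2 (by linarith))
    rw [show d / q - 1 = -(2 * r / q) by rw [hd]; field_simp; ring] at h1
    calc _ ≤ (4 * (n : ℝ) ^ (d / q) * K) ^ q := by
          refine Real.rpow_le_rpow hS0 (h1.trans ?_) hq.le
          gcongr
          exact hfrac _ (by rwa [abs_of_nonneg h])
      _ = 4 ^ q * (n : ℝ) ^ d * K ^ q := by
          rw [Real.mul_rpow (by positivity) hK0.le, Real.mul_rpow (by norm_num) (by positivity),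
            ← Real.rpow_mul hn0.le, div_mul_cancel₀ _ hq.ne']
      _ ≤ 4 * (n : ℝ) ^ d * K ^ q := by
          gcongr
          exact hc 4 (by norm_num)
      _ ≤ _ := by nlinarith
  · rw [abs_of_neg h] at habs
    have h1 := sum_rpow_neg_one_sub_le_log hn (s := -d / q) (div_nonneg (by linarith) hq.le)
    rw [show -1 - -d / q = -(2 * r / q) by rw [hd]; field_simp; ring] at h1
    calc _ ≤ (1 + 2 * K) ^ q := by
          refine Real.rpow_le_rpow hS0 (h1.trans ?_) hq.le
          gcongr
          exact hfrac _ (by rwa [abs_of_neg h])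
      _ ≤ 1 ^ q + (2 * K) ^ q := Real.rpow_add_le_add_rpow (by norm_num) (by positivity) hq.le hq1
      _ = 1 + 2 ^ q * K ^ q := by rw [Real.one_rpow, Real.mul_rpow (by norm_num) hK0.le]
      _ ≤ 1 + 2 * K ^ q := by
          gcongr
          exact hc 2 (by norm_num)
      _ ≤ _ := by nlinarith

/-! ### Decreasing sequences with controlled initial sums -/

/-- If the initial sums of a decreasing sequence `y` are at most those of the constant sequence
`a k` plus `T`, then `y ≤ 2 a` outside a set on which `y` has sum at most `2 T`. -/
lemma exists_exceptional_finset {n : ℕ} {y a : Fin n → ℝ} (hy : Antitone y) {T : ℝ} (hT : 0 ≤ T)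
    (h : ∀ k, ∑ i ∈ Finset.Iic k, y i ≤ ((k : ℝ) + 1) * a k + T) :
    ∃ J : Finset (Fin n), ∑ i ∈ J, y i ≤ 2 * T ∧ ∀ i ∉ J, y i ≤ 2 * a i := by
  set I := Finset.univ.filter fun i => 2 * a i < y i with hI
  rcases I.eq_empty_or_nonempty with h0 | h0
  · refine ⟨∅, by simpa using hT, fun i _ => ?_⟩
    by_contra hc
    have : i ∈ I := by simpa [hI] using hc
    simp [h0] at this
  · have hk : 2 * a (I.max' h0) < y (I.max' h0) := by
      have := I.max'_mem h0
      simpa [hI] using this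
    refine ⟨Finset.Iic (I.max' h0), ?_, fun i hi => ?_⟩
    · have h1 := Finset.card_nsmul_le_sum (Finset.Iic (I.max' h0)) y (y (I.max' h0))
        fun i hi => hy (Finset.mem_Iic.1 hi)
      rw [Fin.card_Iic, nsmul_eq_mul] at h1
      push_cast at h1
      have h2 := h (I.max' h0)
      have h3 : (0 : ℝ) < ((I.max' h0 : Fin n) : ℝ) + 1 := by positivity
      nlinarith
    · by_contra hc
      exact hi (Finset.mem_Iic.2 (I.le_max' i (by simpa [hI] using hc)))

lemma sum_mul_rpow_le_of_initial_sums {n : ℕ} (hn : 3 ≤ n) {t r p : ℝ} (ht : 0 < t)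
    (hr : 0 ≤ r) (hp : 3 / 2 ≤ p) {y : Fin n → ℝ} (hy : Antitone y) (hy0 : ∀ i, 0 ≤ y i)
    (h : ∀ k : Fin n, ∑ i ∈ Finset.Iic k, y i ≤
      ((k : ℝ) + 1) * (12 * Real.log (Real.exp 1 * n / (k + 1))) + 2 * t ^ 2) :
    ∑ i : Fin n, ((i : ℝ) + 1) ^ (-(2 * r)) * y i ^ (p - 1) ≤
      (if r ≤ 1 / 2 then
          (100 : ℝ) ^ p * p ^ p * (n : ℝ) ^ (1 - 2 * r) * Real.log n ^ p /
            (p + (1 - 2 * r) * Real.log n) ^ p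
        else
          (100 : ℝ) ^ p * Real.log n ^ p / (1 + (2 * r - 1) * Real.log n) +
            (100 : ℝ) ^ p * Real.log n ^ (p - 1)) +
      (if p < 2 then
          100 * (1 + (Real.log n / (1 + |2 - 2 * r - p| * Real.log n)) ^ (2 - p) *
            (1 + (n : ℝ) ^ (2 - 2 * r - p)))
        else (100 : ℝ) ^ p) * t ^ (2 * (p - 1)) := by
  obtain ⟨J, hJ, hJc⟩ := exists_exceptional_finset hy (by positivity) h
  have hq : 0 < p - 1 := by linarith
  rw [← Finset.sum_compl_add_sum J]
  have hT : (2 * (2 * t ^ 2)) ^ (p - 1) = 4 ^ (p - 1) * t ^ (2 * (p - 1)) := by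
    rw [← mul_assoc, Real.mul_rpow (by norm_num) (by positivity), Real.rpow_mul ht.le]
    norm_num
  have ht0 : 0 < t ^ (2 * (p - 1)) := by positivity
  have hYJ : 0 ≤ ∑ i ∈ J, y i := Finset.sum_nonneg fun i _ => hy0 i
  refine add_le_add ?_ ?_
  · have h1 : ∑ i ∈ Jᶜ, ((i : ℝ) + 1) ^ (-(2 * r)) * y i ^ (p - 1) ≤
        ∑ i ∈ Finset.range n, ((i : ℝ) + 1) ^ (-(2 * r)) *
          (24 * Real.log (Real.exp 1 * n / (i + 1))) ^ (p - 1) := by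
      rw [← Fin.sum_univ_eq_sum_range (fun i => ((i : ℝ) + 1) ^ (-(2 * r)) *
          (24 * Real.log (Real.exp 1 * n / (i + 1))) ^ (p - 1))]
      refine (Finset.sum_le_sum fun i hi => ?_).trans
        (Finset.sum_le_univ_sum_of_nonneg fun i => ?_)
      · have := hJc i (Finset.mem_compl.1 hi)
        gcongr ?_ * ?_
        exact Real.rpow_le_rpow (hy0 i) (by linarith) hq.le
      · have := (log_exp_mul_div_bounds i.2).1
        positivity
    refine h1.trans ?_
    split_ifs with hc
    · exact sum_log_rpow_le_of_le_half hn hr hc hp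
    · exact sum_log_rpow_le_of_half_lt hn (not_le.1 hc) hp
  · split_ifs with hc
    · have h4 : (4 : ℝ) ^ (p - 1) ≤ 4 := by
        simpa using Real.rpow_le_rpow_of_exponent_le (x := 4) (by norm_num)
          (by linarith : p - 1 ≤ 1)
      have hB := sum_rpow_rpow_le hn hr hp hc
      have hH := sum_mul_rpow_le_holder J (w := fun i : Fin n => ((i : ℝ) + 1) ^ (-(2 * r)))
        (fun i => by positivity) hy0 hq (by linarith)
      rw [show 1 - (p - 1) = 2 - p by ring] at hH
      have hW : ∑ i ∈ J, (((i : ℝ) + 1) ^ (-(2 * r))) ^ (2 - p)⁻¹ ≤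
          ∑ i ∈ Finset.range n, ((i : ℝ) + 1) ^ (-(2 * r / (2 - p))) := by
        rw [← Fin.sum_univ_eq_sum_range (fun i => ((i : ℝ) + 1) ^ (-(2 * r / (2 - p))))]
        refine le_trans (Finset.sum_le_univ_sum_of_nonneg fun i => by positivity)
          (Finset.sum_le_sum fun i _ => ?_)
        rw [← Real.rpow_mul (by positivity), ← div_eq_mul_inv, neg_div]
      have hW0 : 0 ≤ ∑ i ∈ J, (((i : ℝ) + 1) ^ (-(2 * r))) ^ (2 - p)⁻¹ :=
        Finset.sum_nonneg fun i _ => by positivity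
      have hpp : 0 < 2 - p := by linarith
      set B := 1 + (Real.log n / (1 + |2 - 2 * r - p| * Real.log n)) ^ (2 - p) *
            (1 + (n : ℝ) ^ (2 - 2 * r - p))
      have hB0 : 0 < B := by positivity
      calc _ ≤ _ := hH
        _ ≤ (4 * B) * (2 * (2 * t ^ 2)) ^ (p - 1) := by
            gcongr
            exact le_trans (by gcongr) hB
        _ = (4 * B) * (4 ^ (p - 1) * t ^ (2 * (p - 1))) := by rw [hT]
        _ ≤ (4 * B) * (4 * t ^ (2 * (p - 1))) := by gcongr
        _ ≤ _ := by nlinarith [mul_pos hB0 ht0]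
    · have hp2 : 2 ≤ p := not_lt.1 hc
      calc _ ≤ ∑ i ∈ J, y i ^ (p - 1) := by
            refine Finset.sum_le_sum fun i _ => mul_le_of_le_one_left
              (Real.rpow_nonneg (hy0 i) _) ?_
            exact Real.rpow_le_one_of_one_le_of_nonpos
              (by linarith [(Nat.cast_nonneg (i : ℕ) : (0 : ℝ) ≤ (i : ℕ))]) (by linarith)
        _ ≤ (∑ i ∈ J, y i) ^ (p - 1) := sum_rpow_le_rpow_sum J hy0 (by linarith)
        _ ≤ (2 * (2 * t ^ 2)) ^ (p - 1) := by gcongr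
        _ = 4 ^ (p - 1) * t ^ (2 * (p - 1)) := hT
        _ ≤ 100 ^ p * t ^ (2 * (p - 1)) := by
            gcongr
            calc (4 : ℝ) ^ (p - 1) ≤ 100 ^ (p - 1) :=
                  Real.rpow_le_rpow (by norm_num) (by norm_num) hq.le
              _ ≤ 100 ^ p := Real.rpow_le_rpow_of_exponent_le (by norm_num) (by linarith)

/-! ### Sums of squares of Gaussian coordinates -/

lemma gaussianPDFReal_mul_exp_sq (x : ℝ) :
    gaussianPDFReal 0 1 x * Real.exp (x ^ 2 / 4) =
      (√(2 * Real.pi))⁻¹ * Real.exp (-(1 / 4) * x ^ 2) := by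
  rw [gaussianPDFReal_def]
  simp only [NNReal.coe_one, mul_one, sub_zero]
  rw [mul_assoc, ← Real.exp_add]
  ring_nf

lemma integrable_exp_sq_gaussianReal :
    Integrable (fun x : ℝ => Real.exp (x ^ 2 / 4)) (gaussianReal 0 1) := by
  rw [gaussianReal_of_var_ne_zero 0 one_ne_zero,
    integrable_withDensity_iff_integrable_smul' (measurable_gaussianPDF 0 1)
      (ae_of_all _ fun x => gaussianPDF_lt_top)]
  simp only [toReal_gaussianPDF, smul_eq_mul, gaussianPDFReal_mul_exp_sq]
  exact (integrable_exp_neg_mul_sq (by norm_num)).const_mul _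

lemma integral_exp_sq_gaussianReal :
    ∫ x, Real.exp (x ^ 2 / 4) ∂(gaussianReal 0 1) = √2 := by
  rw [integral_gaussianReal_eq_integral_smul one_ne_zero]
  simp only [smul_eq_mul, gaussianPDFReal_mul_exp_sq]
  rw [integral_const_mul, integral_gaussian, ← Real.sqrt_inv, ← Real.sqrt_mul (by positivity)]
  congr 1
  field_simp
  norm_num

lemma exp_sum_sq_eq_prod {n : ℕ} (I : Finset (Fin n)) (x : Fin n → ℝ) :
    Real.exp ((∑ i ∈ I, x i ^ 2) / 4) =
      ∏ i, (if i ∈ I then fun u : ℝ => Real.exp (u ^ 2 / 4) else fun _ => 1) (x i) := by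
  rw [Finset.sum_div, Real.exp_sum, ← Finset.prod_subset (Finset.subset_univ I)]
  · exact Finset.prod_congr rfl fun i hi => by simp [hi]
  · intro i _ hi
    simp [hi]

lemma integrable_exp_sum_sq {n : ℕ} (I : Finset (Fin n)) :
    Integrable (fun x : Fin n → ℝ => Real.exp ((∑ i ∈ I, x i ^ 2) / 4))
      (stdGaussian n) := by
  simp only [exp_sum_sq_eq_prod]
  refine Integrable.fintype_prod (μ := fun _ => gaussianReal 0 1) fun i => ?_
  split_ifs
  · exact integrable_exp_sq_gaussianReal
  · exact integrable_const 1

lemma integral_exp_sum_sq {n : ℕ} (I : Finset (Fin n)) :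
    ∫ x, Real.exp ((∑ i ∈ I, x i ^ 2) / 4) ∂(stdGaussian n) = √2 ^ I.card := by
  simp only [exp_sum_sq_eq_prod]
  refine (integral_fintype_prod_eq_prod (μ := fun _ => gaussianReal 0 1) _).trans ?_
  rw [← Finset.prod_subset (Finset.subset_univ I)]
  · rw [Finset.prod_congr rfl fun i hi => by rw [if_pos hi, integral_exp_sq_gaussianReal],
      Finset.prod_const]
  · intro i _ hi
    simp [hi]

instance isProbabilityMeasure_stdGaussian (n : ℕ) :
    IsProbabilityMeasure (stdGaussian n) := by
  unfold _root_.stdGaussian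
  infer_instance

/-- The subsets of each size receive the same weight, summable over the sizes. -/
noncomputable def subsetWeight (n k : ℕ) : ℝ := (n.choose k * 4 ^ k : ℝ)⁻¹

lemma sum_subsetWeight_mul_le (n : ℕ) :
    ∑ I : Finset (Fin n), subsetWeight n I.card * √2 ^ I.card ≤ 2 := by
  rw [← Finset.powerset_univ,
    Finset.sum_powerset_apply_card (fun k => subsetWeight n k * √2 ^ k), Finset.card_univ,
    Fintype.card_fin]
  calc _ ≤ ∑ k ∈ Finset.range (n + 1), (1 / 2 : ℝ) ^ k := by
        refine Finset.sum_le_sum fun k hk => ?_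
        have hc : (0 : ℝ) < n.choose k := by
          exact_mod_cast Nat.choose_pos (Nat.lt_succ_iff.1 (Finset.mem_range.1 hk))
        have h2 : √2 ≤ 2 := by
          rw [Real.sqrt_le_left (by norm_num)]
          norm_num
        calc _ = (√2 / 4) ^ k := by
              rw [subsetWeight, nsmul_eq_mul, div_pow]
              field_simp
          _ ≤ _ := pow_le_pow_left₀ (by positivity) (by linarith) k
    _ ≤ 2 := sum_geometric_two_le _

lemma measureReal_exists_large_sum_sq_le (n : ℕ) (t : ℝ) :
    (stdGaussian n).real {x | Real.exp (t ^ 2 / 2) ≤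
      ∑ I : Finset (Fin n), subsetWeight n I.card * Real.exp ((∑ i ∈ I, x i ^ 2) / 4)} ≤
      2 * Real.exp (-t ^ 2 / 2) := by
  have hw : ∀ k, 0 ≤ subsetWeight n k := fun k => by unfold subsetWeight; positivity
  have h := mul_meas_ge_le_integral_of_nonneg (μ := stdGaussian n)
    (f := fun x => ∑ I : Finset (Fin n),
      subsetWeight n I.card * Real.exp ((∑ i ∈ I, x i ^ 2) / 4))
    (ae_of_all _ fun x => Finset.sum_nonneg fun I _ => mul_nonneg (hw _) (Real.exp_nonneg _))
    (integrable_finsetSum _ fun I _ => (integrable_exp_sum_sq I).const_mul _)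
    (Real.exp (t ^ 2 / 2))
  rw [integral_finsetSum _ fun I _ => (integrable_exp_sum_sq I).const_mul _] at h
  simp only [integral_const_mul, integral_exp_sum_sq] at h
  replace h := h.trans (sum_subsetWeight_mul_le n)
  rw [neg_div, Real.exp_neg, ← div_eq_mul_inv, le_div_iff₀ (Real.exp_pos _), mul_comm]
  exact h

lemma log_choose_mul_le {n k : ℕ} (hk : 0 < k) (hkn : k ≤ n) :
    Real.log (n.choose k * 4 ^ k) ≤ k * (3 * Real.log (Real.exp 1 * n / k)) := by
  have hk0 : (0 : ℝ) < k := by exact_mod_cast hk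
  have hkn' : (k : ℝ) ≤ n := by exact_mod_cast hkn
  have hc : (0 : ℝ) < n.choose k := by exact_mod_cast Nat.choose_pos hkn
  have hn0 : (0 : ℝ) < n := by linarith
  set u := Real.exp 1 * n / k with hu
  have hu2 : 2 ≤ u := by
    rw [hu, le_div_iff₀ hk0]
    nlinarith [Real.add_one_le_exp (1 : ℝ)]
  have h1 : (n.choose k : ℝ) ≤ u ^ k := by
    have hf := Real.pow_div_factorial_le_exp k hk0.le k
    have hf0 : (0 : ℝ) < k.factorial := by positivity
    calc (n.choose k : ℝ) ≤ (n : ℝ) ^ k / k.factorial := Nat.choose_le_pow_div k n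
      _ = (n / k : ℝ) ^ k * ((k : ℝ) ^ k / k.factorial) := by
          rw [div_pow]
          field_simp
      _ ≤ (n / k : ℝ) ^ k * Real.exp k := by gcongr
      _ = u ^ k := by
          rw [hu, ← Real.exp_one_pow, ← mul_pow]
          ring_nf
  calc _ ≤ Real.log (u ^ k * (u ^ 2) ^ k) := by
        refine Real.log_le_log (by positivity) ?_
        gcongr
        nlinarith
    _ = _ := by
        rw [← mul_pow, Real.log_pow, ← pow_succ', Real.log_pow]
        norm_num

lemma sum_sq_le_of_weighted_sum_lt {n : ℕ} {t : ℝ} {x : Fin n → ℝ}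
    (hx : ∑ I : Finset (Fin n), subsetWeight n I.card * Real.exp ((∑ i ∈ I, x i ^ 2) / 4) <
      Real.exp (t ^ 2 / 2)) {I : Finset (Fin n)} (hI : I.Nonempty) :
    ∑ i ∈ I, x i ^ 2 ≤ I.card * (12 * Real.log (Real.exp 1 * n / I.card)) + 2 * t ^ 2 := by
  have hkn : I.card ≤ n := by simpa using Finset.card_le_univ I
  have hc : (0 : ℝ) < n.choose I.card := by exact_mod_cast Nat.choose_pos hkn
  have hw : ∀ k, 0 ≤ subsetWeight n k := fun k => by unfold subsetWeight; positivity
  have h1 : subsetWeight n I.card * Real.exp ((∑ i ∈ I, x i ^ 2) / 4) < Real.exp (t ^ 2 / 2) :=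
    (Finset.single_le_sum (f := fun I : Finset (Fin n) =>
      subsetWeight n I.card * Real.exp ((∑ i ∈ I, x i ^ 2) / 4))
      (fun I _ => mul_nonneg (hw _) (Real.exp_nonneg _)) (Finset.mem_univ I)).trans_lt hx
  rw [subsetWeight, inv_mul_lt_iff₀ (by positivity)] at h1
  have h2 := Real.log_lt_log (Real.exp_pos _) h1
  rw [Real.log_exp, Real.log_mul (by positivity) (Real.exp_pos _).ne', Real.log_exp] at h2
  have h3 := log_choose_mul_le hI.card_pos hkn
  linarith

lemma decRe_nonneg {n : ℕ} (x : Fin n → ℝ) (i : Fin n) : 0 ≤ decRe x i := abs_nonneg _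

lemma decRe_antitone {n : ℕ} (x : Fin n → ℝ) : Antitone (decRe x) := fun _ _ hij =>
  Tuple.monotone_sort (fun j => |x j|) (Fin.rev_le_rev.2 hij)

/-- The sum of the `k + 1` largest squares is a sum over some set of size `k + 1`. -/
lemma exists_sum_decRe_sq_eq {n : ℕ} (x : Fin n → ℝ) (k : Fin n) :
    ∃ I : Finset (Fin n), I.card = (k : ℕ) + 1 ∧
      ∑ i ∈ Finset.Iic k, decRe x i ^ 2 = ∑ i ∈ I, x i ^ 2 := by
  refine ⟨(Finset.Iic k).map (Fin.revPerm.trans (Tuple.sort fun j => |x j|)).toEmbedding,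
    by simp, ?_⟩
  rw [Finset.sum_map]
  simp [decRe]

theorem gradient_bound_case_I :
    ∃ C : ℝ, 0 < C ∧
      ∀ (n : ℕ) (t r p : ℝ), 3 ≤ n → 0 < t → 0 ≤ r → 3 / 2 ≤ p →
        1 - C * Real.exp (-t ^ 2 / 2) ≤
          ((stdGaussian n) {x |
            ∑ i : Fin n, ((i : ℝ) + 1) ^ (-(2 * r)) * decRe x i ^ (2 * (p - 1)) ≤
              (if r ≤ 1 / 2 then
                  C ^ p * p ^ p * (n : ℝ) ^ (1 - 2 * r) * Real.log n ^ p /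
                    (p + (1 - 2 * r) * Real.log n) ^ p
                else
                  C ^ p * Real.log n ^ p / (1 + (2 * r - 1) * Real.log n) +
                    C ^ p * Real.log n ^ (p - 1)) +
              (if p < 2 then
                  C * (1 + (Real.log n / (1 + |2 - 2 * r - p| * Real.log n)) ^ (2 - p) *
                    (1 + (n : ℝ) ^ (2 - 2 * r - p)))
                else C ^ p) * t ^ (2 * (p - 1))}).toReal := by
  refine ⟨100, by norm_num, fun n t r p hn ht hr hp => ?_⟩
  set N : Set (Fin n → ℝ) := {x | Real.exp (t ^ 2 / 2) ≤
    ∑ I : Finset (Fin n), subsetWeight n I.card * Real.exp ((∑ i ∈ I, x i ^ 2) / 4)}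
  have hNm : MeasurableSet N := measurableSet_le measurable_const (by fun_prop)
  have hNle : (stdGaussian n).real N ≤ 2 * Real.exp (-t ^ 2 / 2) :=
    measureReal_exists_large_sum_sq_le n t
  have hNc : 1 - 100 * Real.exp (-t ^ 2 / 2) ≤ (stdGaussian n).real Nᶜ := by
    rw [probReal_compl_eq_one_sub hNm]
    linarith [Real.exp_pos (-t ^ 2 / 2)]
  refine hNc.trans (measureReal_mono fun x hx => ?_)
  have hx' : ∑ I : Finset (Fin n), subsetWeight n I.card * Real.exp ((∑ i ∈ I, x i ^ 2) / 4) <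
      Real.exp (t ^ 2 / 2) := not_le.1 hx
  have hsq : ∀ i, decRe x i ^ (2 * (p - 1)) = (decRe x i ^ 2) ^ (p - 1) := fun i => by
    rw [Real.rpow_mul (decRe_nonneg x i), Real.rpow_two]
  simp only [Set.mem_ofPred_eq, hsq]
  refine sum_mul_rpow_le_of_initial_sums hn ht hr hp
    (fun i j hij => pow_le_pow_left₀ (decRe_nonneg x j) (decRe_antitone x hij) 2)
    (fun i => sq_nonneg _) fun k => ?_
  obtain ⟨I, hI, hIsum⟩ := exists_sum_decRe_sq_eq x k
  have h := sum_sq_le_of_weighted_sum_lt hx' (I := I) (Finset.card_pos.1 (by omega))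
  rw [hI] at h
  push_cast at h
  rwa [hIsum]
end
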